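/- Let g be a hyperbolic element of G. Then the centralizer C(g) = {a ∈ G : ag = ga} of g in G is a strongly relatively quasi-convex subgroup of G. -/

import Mathlib

namespace RelHyp

variable {G : Type*} [Group G] {Λ : Type*}

/-- Length of a shortest word over the alphabet `S ∪ S⁻¹` representing `g`. -/
noncomputable def wordLength (S : Set G) (g : G) : ℕ :=
  sInf {n | ∃ w : List G, w.length = n ∧ (∀ x ∈ w, x ∈ S ∨ x⁻¹ ∈ S) ∧ w.prod = g}

/-- The free product `F = (∗_λ H_λ) ∗ F(X)`. -/
abbrev RelFree (H : Λ → Subgroup G) (X : Set G) : Type _ :=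
  Monoid.Coprod (Monoid.CoprodI fun l => ↥(H l)) (FreeGroup ↥X)

/-- The canonical homomorphism `ε : F → G`. -/
def relEps (H : Λ → Subgroup G) (X : Set G) : RelFree H X →* G :=
  Monoid.Coprod.lift (Monoid.CoprodI.lift fun l => (H l).subtype)
    (FreeGroup.lift fun x => (x : G))

/-- Letters of the alphabet `X ∪ 𝓗`, where `𝓗 = ⊔_λ (H̃_λ ∖ {1})`. -/
abbrev RelLetter (H : Λ → Subgroup G) (X : Set G) : Type _ :=
  (Σ l : Λ, {h : ↥(H l) // h ≠ 1}) ⊕ (↥X × Bool)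

/-- The image of a letter in the free product `F`. -/
def RelLetter.toF {H : Λ → Subgroup G} {X : Set G} : RelLetter H X → RelFree H X
  | Sum.inl ⟨_, h⟩ => Monoid.Coprod.inl (Monoid.CoprodI.of h.1)
  | Sum.inr (x, b) => Monoid.Coprod.inr (if b then FreeGroup.of x else (FreeGroup.of x)⁻¹)

/-- The element of `G` represented by a letter. -/
def RelLetter.val {H : Λ → Subgroup G} {X : Set G} : RelLetter H X → G
  | Sum.inl ⟨_, h⟩ => (h.1 : G)
  | Sum.inr (x, b) => if b then (x : G) else (x : G)⁻¹

/-- The index `λ` such that the letter belongs to `H̃_λ`, if any. -/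
def RelLetter.hIndex {H : Λ → Subgroup G} {X : Set G} : RelLetter H X → Option Λ
  | Sum.inl ⟨l, _⟩ => some l
  | Sum.inr _ => none

/-- The element of `F` represented by a word over `X ∪ 𝓗`. -/
def wordToF {H : Λ → Subgroup G} {X : Set G} (w : List (RelLetter H X)) : RelFree H X :=
  (w.map RelLetter.toF).prod

/-- `f` is a relative isoperimetric function of the relative presentation `⟨X, H | R⟩`. -/
def IsIsoperFn (H : Λ → Subgroup G) (X : Set G) (R : Set (RelFree H X)) (f : ℕ → ℕ) : Prop :=
  ∀ w : List (RelLetter H X), relEps H X (wordToF w) = 1 →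
    ∃ k ≤ f w.length, ∃ r c : Fin k → RelFree H X,
      (∀ i, r i ∈ R) ∧ wordToF w = (List.ofFn fun i => (c i)⁻¹ * r i * c i).prod

/-- `⟨X, H | R⟩` is a finite relative presentation of `G` w.r.t. the collection `H`. -/
structure IsFiniteRelPres (H : Λ → Subgroup G) (X : Set G) (R : Set (RelFree H X)) : Prop where
  finX : X.Finite
  finR : R.Finite
  surj : Function.Surjective (relEps H X)
  ker : (relEps H X).ker = Subgroup.normalClosure R

/-- `G` is finitely presented relative to the collection of subgroups `H`. -/
def FinitelyPresentedRel (H : Λ → Subgroup G) : Prop :=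
  ∃ (X : Set G) (R : Set (RelFree H X)), IsFiniteRelPres H X R

/-- The relative area of a word representing `1`. -/
noncomputable def relArea (H : Λ → Subgroup G) (X : Set G) (R : Set (RelFree H X))
    (w : List (RelLetter H X)) : ℕ :=
  sInf {k | ∃ r c : Fin k → RelFree H X,
    (∀ i, r i ∈ R) ∧ wordToF w = (List.ofFn fun i => (c i)⁻¹ * r i * c i).prod}

/-- The relative Dehn function of the presentation `⟨X, H | R⟩`. -/
noncomputable def relDehn (H : Λ → Subgroup G) (X : Set G) (R : Set (RelFree H X))
    (n : ℕ) : ℕ :=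
  sSup {a | ∃ w : List (RelLetter H X), w.length ≤ n ∧ relEps H X (wordToF w) = 1 ∧
    a = relArea H X R w}

/-- The relative Dehn function is well-defined (finite for each value of the argument),
i.e. there exists a finite-valued relative isoperimetric function. -/
def DehnWellDefined (H : Λ → Subgroup G) (X : Set G) (R : Set (RelFree H X)) : Prop :=
  ∃ f : ℕ → ℕ, IsIsoperFn H X R f

/-- `f ⪯ g`. -/
def AsympLE (f g : ℕ → ℕ) : Prop := ∃ C K L : ℕ, ∀ n, f n ≤ C * g (K * n) + L * n

/-- `f ∼ g`. -/
def AsympEquiv (f g : ℕ → ℕ) : Prop := AsympLE f g ∧ AsympLE g f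

/-- `G` is hyperbolic relative to `H`: it admits a finite relative presentation with a
linear relative isoperimetric function. -/
def IsRelHyperbolic (H : Λ → Subgroup G) : Prop :=
  ∃ (X : Set G) (R : Set (RelFree H X)), IsFiniteRelPres H X R ∧
    ∃ A B : ℕ, IsIsoperFn H X R fun n => A * n + B

/-- The subnegative closure of `f`. -/
noncomputable def subnegClosure (f : ℕ → ℕ) (n : ℕ) : ℕ :=
  sSup {s | ∃ L : List ℕ, (∀ a ∈ L, 0 < a) ∧ L.sum = n ∧ s = (L.map f).sum}

/-- A combinatorial path in the Cayley graph `Γ(G, X ∪ 𝓗)`: a starting vertex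
together with the word labelling the path. -/
structure RelPath (H : Λ → Subgroup G) (X : Set G) where
  start : G
  word : List (RelLetter H X)

namespace RelPath

variable {H : Λ → Subgroup G} {X : Set G}

/-- The length of the path. -/
def len (p : RelPath H X) : ℕ := p.word.length

/-- The `k`-th vertex of the path. -/
def vertex (p : RelPath H X) (k : ℕ) : G :=
  p.start * ((p.word.take k).map RelLetter.val).prod

/-- The terminal vertex of the path. -/
def finish (p : RelPath H X) : G := p.vertex p.word.length

end RelPath

/-- The combinatorial metric `dist_{X ∪ 𝓗}` on `G`. -/
noncomputable def relDist (H : Λ → Subgroup G) (X : Set G) (g h : G) : ℕ :=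
  wordLength (X ∪ ⋃ l, (H l : Set G)) (g⁻¹ * h)

/-- The relative length `|g|_{X ∪ 𝓗}`. -/
noncomputable def relLen (H : Λ → Subgroup G) (X : Set G) (g : G) : ℕ :=
  wordLength (X ∪ ⋃ l, (H l : Set G)) g

/-- The word metric `dist_X` on `G`. -/
noncomputable def xDist (X : Set G) (g h : G) : ℕ := wordLength X (g⁻¹ * h)

variable {H : Λ → Subgroup G} {X : Set G}

/-- `p` is a `(λ, c)`-quasi-geodesic in `Γ(G, X ∪ 𝓗)`. -/
def IsQuasiGeodesic (lam c : ℝ) (p : RelPath H X) : Prop :=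
  ∀ i j : ℕ, i ≤ j → j ≤ p.len →
    ((j - i : ℕ) : ℝ) ≤ lam * (relDist H X (p.vertex i) (p.vertex j) : ℝ) + c

/-- `p` is a geodesic in `Γ(G, X ∪ 𝓗)`. -/
def IsGeodesic (p : RelPath H X) : Prop :=
  ∀ i j : ℕ, i ≤ j → j ≤ p.len → j - i = relDist H X (p.vertex i) (p.vertex j)

/-- The `k`-th letter of `p` is a letter of `H̃_l`. -/
def LetterIsH (p : RelPath H X) (l : Λ) (k : ℕ) : Prop :=
  ∃ a, p.word[k]? = some a ∧ a.hIndex = some l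

/-- The subpath of `p` consisting of the letters with indices `a, …, b` is an
`H_l`-component of `p` (a maximal nonempty `H_l`-subword). -/
def IsComponent (p : RelPath H X) (l : Λ) (a b : ℕ) : Prop :=
  a ≤ b ∧ b < p.len ∧ (∀ k, a ≤ k → k ≤ b → LetterIsH p l k) ∧
    (a = 0 ∨ ¬ LetterIsH p l (a - 1)) ∧ (b + 1 = p.len ∨ ¬ LetterIsH p l (b + 1))

/-- The `H_l`-components of `p` starting at index `a` and of `q` starting at `a'`
are connected (their vertices lie in the same left coset of `H_l`). -/
def ConnectedComp (p q : RelPath H X) (l : Λ) (a a' : ℕ) : Prop :=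
  (p.vertex a)⁻¹ * q.vertex a' ∈ H l

/-- `p` is a path without backtracking: all of its components are isolated. -/
def NoBacktracking (p : RelPath H X) : Prop :=
  ∀ l a b a' b', IsComponent p l a b → IsComponent p l a' b' →
    ConnectedComp p p l a a' → a = a' ∧ b = b'

/-- The `k`-th vertex of `p` is a phase vertex (not an inner vertex of a component). -/
def IsPhase (p : RelPath H X) (k : ℕ) : Prop :=
  ¬ ∃ l a b, IsComponent p l a b ∧ a < k ∧ k ≤ b

/-- `p` and `q` are `k`-similar: their endpoints are `X`-distance at most `k` apart. -/
def Similar (k : ℝ) (p q : RelPath H X) : Prop :=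
  (xDist X p.start q.start : ℝ) ≤ k ∧ (xDist X p.finish q.finish : ℝ) ≤ k

/-- The Rips thin-triangles condition for `Γ(G, X ∪ 𝓗)` with constant `δ`. -/
def RipsThin (H : Λ → Subgroup G) (X : Set G) (δ : ℝ) : Prop :=
  ∀ p q r : RelPath H X, IsGeodesic p → IsGeodesic q → IsGeodesic r →
    p.finish = q.start → q.finish = r.start → r.finish = p.start →
    ∀ i ≤ p.len, ∃ j : ℕ,
      (j ≤ q.len ∧ (relDist H X (p.vertex i) (q.vertex j) : ℝ) ≤ δ) ∨
      (j ≤ r.len ∧ (relDist H X (p.vertex i) (r.vertex j) : ℝ) ≤ δ)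

/-- The Cayley graph `Γ(G, X ∪ 𝓗)` is a hyperbolic metric space. -/
def CayleyHyperbolic (H : Λ → Subgroup G) (X : Set G) : Prop :=
  ∃ δ : ℝ, 0 ≤ δ ∧ RipsThin H X δ

/-- `R` is a relatively quasi-convex subgroup of `G`. -/
def RelQuasiconvex (H : Λ → Subgroup G) (X : Set G) (R : Subgroup G) : Prop :=
  ∃ σ : ℝ, 0 < σ ∧ ∀ p : RelPath H X, IsGeodesic p → p.start ∈ R → p.finish ∈ R →
    ∀ k ≤ p.len, ∃ w ∈ R, (xDist X (p.vertex k) w : ℝ) ≤ σ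

/-- `R` is a strongly relatively quasi-convex subgroup of `G`. -/
def StronglyRelQuasiconvex (H : Λ → Subgroup G) (X : Set G) (R : Subgroup G) : Prop :=
  RelQuasiconvex H X R ∧ ∀ (g : G) (l : Λ), {x : G | x ∈ R ∧ g * x * g⁻¹ ∈ H l}.Finite

/-- `g` is a hyperbolic element: it is not conjugate to an element of any `H_λ`. -/
def IsHypElt (H : Λ → Subgroup G) (g : G) : Prop :=
  ∀ l : Λ, ∀ x ∈ H l, ¬ IsConj g x

end RelHyp

open RelHyp

namespace RelHyp

section WordLength

variable {G : Type*} [Group G] {S : Set G}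

theorem exists_word (hS : Subgroup.closure S = ⊤) (g : G) :
    ∃ w : List G, w.length = wordLength S g ∧ (∀ x ∈ w, x ∈ S ∨ x⁻¹ ∈ S) ∧ w.prod = g := by
  have hne : {n | ∃ w : List G, w.length = n ∧ (∀ x ∈ w, x ∈ S ∨ x⁻¹ ∈ S) ∧
      w.prod = g}.Nonempty := by
    have hg : g ∈ (Subgroup.closure S).toSubmonoid := by rw [hS]; trivial
    rw [Subgroup.closure_toSubmonoid] at hg
    obtain ⟨w, hw, rfl⟩ := Submonoid.exists_list_of_mem_closure hg
    exact ⟨_, w, rfl, fun x hx => hw x hx, rfl⟩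
  exact Nat.sInf_mem hne

theorem wordLength_le {w : List G} (hw : ∀ x ∈ w, x ∈ S ∨ x⁻¹ ∈ S) :
    wordLength S w.prod ≤ w.length :=
  Nat.sInf_le ⟨w, rfl, hw, rfl⟩

@[simp] theorem wordLength_one : wordLength S (1 : G) = 0 :=
  Nat.le_zero.1 (wordLength_le (S := S) (w := []) (by simp))

theorem wordLength_le_one {g : G} (hg : g ∈ S ∨ g⁻¹ ∈ S) : wordLength S g ≤ 1 := by
  have := wordLength_le (S := S) (w := [g]) (by simpa using hg)
  simpa using this

theorem wordLength_mul_le (hS : Subgroup.closure S = ⊤) (a b : G) :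
    wordLength S (a * b) ≤ wordLength S a + wordLength S b := by
  obtain ⟨v, hv, hvS, rfl⟩ := exists_word hS a
  obtain ⟨w, hw, hwS, rfl⟩ := exists_word hS b
  rw [← hv, ← hw, ← List.length_append, ← List.prod_append]
  refine wordLength_le fun x hx => ?_
  rcases List.mem_append.1 hx with h | h
  exacts [hvS x h, hwS x h]

theorem wordLength_inv_le (hS : Subgroup.closure S = ⊤) (a : G) :
    wordLength S a⁻¹ ≤ wordLength S a := by
  obtain ⟨v, hv, hvS, rfl⟩ := exists_word hS a
  rw [← hv, List.prod_inv_reverse]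
  refine (wordLength_le fun x hx => ?_).trans (by simp)
  simp only [List.mem_reverse, List.mem_map] at hx
  obtain ⟨y, hy, rfl⟩ := hx
  simpa using (hvS y hy).symm

theorem wordLength_inv (hS : Subgroup.closure S = ⊤) (a : G) :
    wordLength S a⁻¹ = wordLength S a :=
  (wordLength_inv_le hS a).antisymm (by simpa using wordLength_inv_le hS a⁻¹)

theorem eq_one_or_mem_of_wordLength_le_one (hS : Subgroup.closure S = ⊤) {a : G}
    (ha : wordLength S a ≤ 1) : a = 1 ∨ a ∈ S ∨ a⁻¹ ∈ S := by
  obtain ⟨v, hv, hvS, rfl⟩ := exists_word hS a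
  match v with
  | [] => simp
  | [x] => simpa using Or.inr (hvS x (by simp))
  | _ :: _ :: _ => simp only [List.length_cons] at hv; omega

theorem finite_setOf_wordLength_le (hS : Subgroup.closure S = ⊤) (hfin : S.Finite) (n : ℕ) :
    {a : G | wordLength S a ≤ n}.Finite := by
  have hT : (S ∪ S⁻¹).Finite := hfin.union hfin.inv
  have := hT.to_subtype
  refine ((List.finite_length_le (S ∪ S⁻¹ : Set G) n).image
    fun w => (w.map Subtype.val).prod).subset ?_
  intro a ha
  obtain ⟨v, hv, hvS, rfl⟩ := exists_word hS a
  refine ⟨v.attach.map fun x => ⟨x.1, by simpa using hvS x.1 x.2⟩, ?_, ?_⟩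
  · simpa [hv] using ha
  · simp [Function.comp_def]

/-- The word metric associated with `S`. -/
noncomputable def wdist (S : Set G) (a b : G) : ℕ := wordLength S (a⁻¹ * b)

@[simp] theorem wdist_self (a : G) : wdist S a a = 0 := by simp [wdist]

@[simp] theorem wdist_mul_left (c a b : G) : wdist S (c * a) (c * b) = wdist S a b := by
  simp [wdist, mul_assoc]

theorem wdist_comm (hS : Subgroup.closure S = ⊤) (a b : G) : wdist S a b = wdist S b a := by
  rw [wdist, ← wordLength_inv hS]; simp [wdist]

theorem wdist_triangle (hS : Subgroup.closure S = ⊤) (a b c : G) :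
    wdist S a c ≤ wdist S a b + wdist S b c := by
  have := wordLength_mul_le hS (a⁻¹ * b) (b⁻¹ * c)
  simpa [wdist, mul_assoc] using this

theorem abs_wdist_sub_le (hS : Subgroup.closure S = ⊤) (u v w : G) :
    |(wdist S u v : ℤ) - wdist S u w| ≤ wdist S v w := by
  have h1 := wdist_triangle hS u v w
  have h2 := wdist_triangle hS u w v
  rw [wdist_comm hS w v] at h2
  rw [abs_le]; constructor <;> omega

/-- The first `n + 1` terms of `p` are the vertices of a geodesic. -/
def Geo (S : Set G) (p : ℕ → G) (n : ℕ) : Prop :=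
  ∀ i j, i ≤ j → j ≤ n → wdist S (p i) (p j) = j - i

theorem exists_geo (hS : Subgroup.closure S = ⊤) (v w : G) :
    ∃ p : ℕ → G, p 0 = v ∧ p (wdist S v w) = w ∧ Geo S p (wdist S v w) := by
  obtain ⟨L, hL, hLS, hprod⟩ := exists_word hS (v⁻¹ * w)
  have hn : L.length = wdist S v w := hL
  have key : ∀ i j, i ≤ j → j ≤ L.length →
      wdist S (v * (L.take i).prod) (v * (L.take j).prod) ≤ j - i := by
    intro i j hij hj
    have h : L.take j = L.take i ++ (L.drop i).take (j - i) := by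
      rw [← List.take_add]; congr 1; omega
    rw [h, List.prod_append, wdist_mul_left, wdist, inv_mul_cancel_left]
    refine (wordLength_le fun x hx => hLS x ?_).trans (by simp)
    exact List.mem_of_mem_drop (List.mem_of_mem_take hx)
  refine ⟨fun i => v * (L.take i).prod, by simp, ?_, ?_⟩
  · simp [← hn, hprod]
  · intro i j hij hj
    rw [← hn] at hj
    refine (key i j hij hj).antisymm ?_
    have h1 := key 0 i (by omega) (by omega)
    have h2 := key j L.length hj le_rfl
    have h3 := wdist_triangle hS v (v * (L.take i).prod) w
    have h4 := wdist_triangle hS (v * (L.take i).prod) (v * (L.take j).prod) w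
    simp only [List.take_zero, List.prod_nil, mul_one, List.take_length, hprod,
      mul_inv_cancel_left] at h1 h2
    omega

theorem Geo.shift {p : ℕ → G} {n : ℕ} (hp : Geo S p n) (k m : ℕ) (hm : k + m ≤ n) :
    Geo S (fun i => p (k + i)) m := by
  intro i j hij hj
  rw [hp (k + i) (k + j) (by omega) (by omega)]; omega

theorem Geo.reverse (hS : Subgroup.closure S = ⊤) {p : ℕ → G} {n : ℕ} (hp : Geo S p n) :
    Geo S (fun i => p (n - i)) n := by
  intro i j hij hj
  rw [wdist_comm hS, hp (n - j) (n - i) (by omega) (by omega)]; omega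

theorem Geo.mul_left {p : ℕ → G} {n : ℕ} (hp : Geo S p n) (c : G) :
    Geo S (fun i => c * p i) n := by
  intro i j hij hj
  rw [wdist_mul_left, hp i j hij hj]

theorem Geo.wdist_eq (hS : Subgroup.closure S = ⊤) {p : ℕ → G} {n : ℕ} (hp : Geo S p n)
    {i j : ℕ} (hi : i ≤ n) (hj : j ≤ n) : (wdist S (p i) (p j) : ℤ) = |(i : ℤ) - j| := by
  rcases le_total i j with h | h
  · rw [hp i j h hj, abs_of_nonpos (by omega)]; omega
  · rw [wdist_comm hS, hp j i h hi, abs_of_nonneg (by omega)]; omega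

end WordLength

section Cocycle

variable {G : Type*} [Group G] {Λ : Type*} {H : Λ → Subgroup G} {Y : Set G}

/-- Integer-valued functions on pairs `(a, v)` that are additive along the path starting at `v`
with label `a`. -/
def IsCocycle {F : Type*} [Group F] (ε : F →* G) (s : F → G → ℤ) : Prop :=
  ∀ a b v, s (a * b) v = s a v + s b (v * ε a)

namespace IsCocycle

variable {F : Type*} [Group F] {ε : F →* G} {s : F → G → ℤ}

theorem map_one (hs : IsCocycle ε s) (v : G) : s 1 v = 0 := by
  have := hs 1 1 v
  simp only [mul_one, _root_.map_one] at this
  omega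

theorem map_inv (hs : IsCocycle ε s) (a : F) (v : G) : s a⁻¹ v = - s a (v * (ε a)⁻¹) := by
  have := hs a⁻¹ a v
  rw [inv_mul_cancel, hs.map_one, _root_.map_inv] at this
  omega

theorem map_conj (hs : IsCocycle ε s) (c r : F) (hr : ε r = 1) (v : G) :
    s (c⁻¹ * r * c) v = s r (v * (ε c)⁻¹) := by
  rw [hs, hs, hs.map_inv]
  simp [hr]

theorem abs_prod_le (hs : IsCocycle ε s) {M : ℤ} (L : List F)
    (hL : ∀ a ∈ L, ε a = 1 ∧ ∀ v, |s a v| ≤ M) (v : G) : |s L.prod v| ≤ L.length * M := by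
  induction L with
  | nil => simp [hs.map_one]
  | cons a L ih =>
    rw [List.prod_cons, hs, (hL a (by simp)).1, mul_one]
    have h1 := (hL a (by simp)).2 v
    have h2 := ih fun b hb => hL b (by simp [hb])
    refine (abs_add_le _ _).trans ?_
    push_cast [List.length_cons]
    linarith

end IsCocycle

/-- The action of `G` by right translations on integer-valued functions on `G`. -/
def translateHom (G : Type*) [Group G] : G →* MulAut (G → Multiplicative ℤ) where
  toFun a :=
    { toFun := fun σ v => σ (v * a)
      invFun := fun σ v => σ (v * a⁻¹)
      left_inv := fun σ => by funext v; simp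
      right_inv := fun σ => by funext v; simp
      map_mul' := fun σ τ => rfl }
  map_one' := by ext; simp
  map_mul' a b := by ext; simp [mul_assoc]

/-- Potentials on the cosets of the `H l` and arbitrary values on the generators in `Y` extend to
a cocycle on the free product. -/
theorem exists_isCocycle (f : Λ → G → ℤ) (b : Y → G → ℤ) :
    ∃ s : RelFree H Y → G → ℤ, IsCocycle (relEps H Y) s ∧
      (∀ (l : Λ) (h : H l) (v : G),
        s (Monoid.Coprod.inl (Monoid.CoprodI.of h)) v = f l (v * h) - f l v) ∧
      ∀ (x : Y) (v : G), s (Monoid.Coprod.inr (FreeGroup.of x)) v = b x v := by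
  let P := (G → Multiplicative ℤ) ⋊[translateHom G] G
  let hH : ∀ l, H l →* P := fun l =>
    { toFun := fun h => ⟨fun v => Multiplicative.ofAdd (f l (v * h) - f l v), h⟩
      map_one' := by
        refine SemidirectProduct.ext ?_ ?_
        · funext v; simp
        · simp
      map_mul' := fun h k => by
        refine SemidirectProduct.ext (funext fun v => ?_) rfl
        change f l (v * (h * k : G)) - f l v =
          (f l (v * h) - f l v) + (f l (v * h * k) - f l (v * h))
        rw [mul_assoc]; ring }
  let Θ : RelFree H Y →* P := Monoid.Coprod.lift (Monoid.CoprodI.lift hH)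
    (FreeGroup.lift fun x => ⟨fun v => Multiplicative.ofAdd (b x v), (x : G)⟩)
  have hΘ : (SemidirectProduct.rightHom).comp Θ = relEps H Y := by
    refine Monoid.Coprod.hom_ext (Monoid.CoprodI.ext_hom _ _ fun l => ?_)
      (FreeGroup.ext_hom _ _ fun x => ?_)
    · ext h; simp [Θ, hH, relEps]
    · simp [Θ, relEps]
  refine ⟨fun a v => Multiplicative.toAdd ((Θ a).left v), fun a b v => ?_, fun l h v => ?_,
    fun x v => ?_⟩
  · have : (Θ a).right = relEps H Y a := DFunLike.congr_fun hΘ a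
    rw [← this]
    beta_reduce
    rw [map_mul]
    rfl
  · simp [Θ, hH]
  · simp [Θ]

theorem relFree_induction {P : RelFree H Y → Prop}
    (of : ∀ (l : Λ) (h : H l), P (Monoid.Coprod.inl (Monoid.CoprodI.of h)))
    (gen : ∀ x : Y, P (Monoid.Coprod.inr (FreeGroup.of x)))
    (one : P 1) (inv : ∀ a, P a → P a⁻¹) (mul : ∀ a b, P a → P b → P (a * b))
    (a : RelFree H Y) : P a := by
  induction a using Monoid.Coprod.induction_on with
  | inl m =>
    induction m using Monoid.CoprodI.induction_on with
    | one => simpa using one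
    | of l h => exact of l h
    | mul x y hx hy => simpa using mul _ _ hx hy
  | inr n =>
    induction n using FreeGroup.induction_on with
    | C1 => simpa using one
    | of x => exact gen x
    | inv_of x hx => simpa using inv _ hx
    | mul x y hx hy => simpa using mul _ _ hx hy
  | mul x y hx hy => exact mul _ _ hx hy

theorem exists_wordToF_eq_of (l : Λ) (h : H l) : ∃ W : List (RelLetter H Y), W.length ≤ 1 ∧
    wordToF W = (Monoid.Coprod.inl (Monoid.CoprodI.of h) : RelFree H Y) := by
  by_cases hh : h = 1
  · exact ⟨[], by simp, by simp [wordToF, hh]⟩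
  · exact ⟨[Sum.inl ⟨l, h, hh⟩], by simp, by simp [wordToF, RelLetter.toF]⟩

/-- Every element of the free product is represented by a word. -/
theorem exists_wordToF_eq (a : RelFree H Y) : ∃ W : List (RelLetter H Y), wordToF W = a := by
  classical
  have hmul : ∀ a b : RelFree H Y, (∃ W : List (RelLetter H Y), wordToF W = a) →
      (∃ W : List (RelLetter H Y), wordToF W = b) →
      ∃ W : List (RelLetter H Y), wordToF W = a * b := by
    rintro _ _ ⟨V, rfl⟩ ⟨W, rfl⟩
    exact ⟨V ++ W, by simp [wordToF]⟩
  induction a using Monoid.Coprod.induction_on with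
  | inl m =>
    induction m using Monoid.CoprodI.induction_on with
    | one => exact ⟨[], by simp [wordToF]⟩
    | of l h => exact (exists_wordToF_eq_of l h).imp fun _ h => h.2
    | mul x y hx hy => simpa using hmul _ _ hx hy
  | inr n =>
    induction n using FreeGroup.induction_on with
    | C1 => exact ⟨[], by simp [wordToF]⟩
    | of x => exact ⟨[Sum.inr (x, true)], by simp [wordToF, RelLetter.toF]⟩
    | inv_of x hx => exact ⟨[Sum.inr (x, false)], by simp [wordToF, RelLetter.toF]⟩
    | mul x y hx hy => simpa using hmul _ _ hx hy
  | mul x y hx hy => exact hmul _ _ hx hy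

theorem relEps_of (l : Λ) (h : H l) :
    relEps H Y (Monoid.Coprod.inl (Monoid.CoprodI.of h)) = h := by simp [relEps]

/-- A linear isoperimetric inequality bounds every cocycle on words representing `1`. -/
theorem IsCocycle.abs_wordToF_le {R : Set (RelFree H Y)} {A B : ℕ}
    (hiso : IsIsoperFn H Y R fun n => A * n + B) (hker : ∀ r ∈ R, relEps H Y r = 1)
    {s : RelFree H Y → G → ℤ} (hs : IsCocycle (relEps H Y) s) {M : ℕ}
    (hM : ∀ r ∈ R, ∀ v, |s r v| ≤ M) (W : List (RelLetter H Y))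
    (hW : relEps H Y (wordToF W) = 1) (v : G) :
    |s (wordToF W) v| ≤ (A * W.length + B : ℕ) * M := by
  obtain ⟨k, hk, r, c, hr, hprod⟩ := hiso W hW
  rw [hprod]
  refine (hs.abs_prod_le (M := M) _ ?_ v).trans ?_
  · intro a ha
    obtain ⟨i, rfl⟩ := (List.mem_ofFn' _ _).1 ha
    refine ⟨by simp [hker _ (hr i)], fun v => ?_⟩
    rw [hs.map_conj _ _ (hker _ (hr i))]
    exact hM _ (hr i) _
  · rw [List.length_ofFn]
    gcongr

end Cocycle

section Isoperimetry

variable {G : Type*} [Group G] {Λ : Type*} {H : Λ → Subgroup G} {X Y : Set G}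

theorem exists_nat_bound {α : Type*} {s : Set α} (hs : s.Finite) {P : α → ℕ → Prop}
    (hP : ∀ a ∈ s, ∃ M, P a M) (hmono : ∀ a M N, M ≤ N → P a M → P a N) :
    ∃ M, ∀ a ∈ s, P a M := by
  classical
  choose! M hM using hP
  refine ⟨hs.toFinset.sup M, fun a ha => hmono a _ _ ?_ (hM a ha)⟩
  exact Finset.le_sup (f := M) (hs.mem_toFinset.2 ha)

/-- `AvoidPath H X l u n v w`: there is a path of length `n` from `v` to `w` in the Cayley graph
of `G` with respect to `X ∪ 𝓗` (allowing constant steps) none of whose `H l`-edges lies in the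
coset `u * H l`. -/
inductive AvoidPath (H : Λ → Subgroup G) (X : Set G) (l : Λ) (u : G) : ℕ → G → G → Prop
  | refl (v : G) : AvoidPath H X l u 0 v v
  | step {n : ℕ} {v z w : G} (h : v = z ∨ (v⁻¹ * z ∈ X ∨ (v⁻¹ * z)⁻¹ ∈ X) ∨
      ∃ m, v⁻¹ * z ∈ H m ∧ ¬ (m = l ∧ u⁻¹ * v ∈ H l)) (hzw : AvoidPath H X l u n z w) :
      AvoidPath H X l u (n + 1) v w

/-- The cocycle `s` measures displacement from `v₀` along the edges of the coset `u * H l`. -/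
structure IsCosetCocycle (H : Λ → Subgroup G) (X Y : Set G) (l : Λ) (u v₀ : G)
    (s : RelFree H Y → G → ℤ) : Prop where
  isCocycle : IsCocycle (relEps H Y) s
  of_avoid : ∀ (m : Λ) (h : H m) (v : G), ¬ (m = l ∧ u⁻¹ * v ∈ H l) →
    s (Monoid.Coprod.inl (Monoid.CoprodI.of h)) v = 0
  of_mem : ∀ (h : H l) (v : G), u⁻¹ * v ∈ H l →
    s (Monoid.Coprod.inl (Monoid.CoprodI.of h)) v = (wdist X v₀ (v * h) : ℤ) - wdist X v₀ v
  gen : ∀ (x : Y) (v : G), s (Monoid.Coprod.inr (FreeGroup.of x)) v = 0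

theorem exists_isCosetCocycle (H : Λ → Subgroup G) (X Y : Set G) (l : Λ) (u v₀ : G) :
    ∃ s, IsCosetCocycle H X Y l u v₀ s := by
  classical
  obtain ⟨s, hs, hof, hgen⟩ := exists_isCocycle (H := H) (Y := Y)
    (fun m v => if m = l ∧ u⁻¹ * v ∈ H l then (wdist X v₀ v : ℤ) else 0) (fun _ _ => 0)
  refine ⟨s, hs, fun m h v hv => ?_, fun h v hv => ?_, hgen⟩
  · have hv' : ¬ (m = l ∧ u⁻¹ * (v * h) ∈ H l) := by
      rintro ⟨rfl, h'⟩
      rw [← mul_assoc, Subgroup.mul_mem_cancel_right _ h.2] at h'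
      exact hv ⟨rfl, h'⟩
    rw [hof, if_neg hv, if_neg hv', sub_zero]
  · have hv' : u⁻¹ * (v * h) ∈ H l := by
      rw [← mul_assoc]; exact mul_mem hv h.2
    rw [hof, if_pos ⟨rfl, hv'⟩, if_pos ⟨rfl, hv⟩]

theorem IsCosetCocycle.exists_bound (hX : Subgroup.closure X = ⊤) (a : RelFree H Y) :
    ∃ M : ℕ, ∀ l u v₀ s, IsCosetCocycle H X Y l u v₀ s → ∀ v, |s a v| ≤ M := by
  induction a using relFree_induction with
  | of m h =>
    refine ⟨wordLength X (h : G), fun l u v₀ s hs v => ?_⟩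
    by_cases hv : m = l ∧ u⁻¹ * v ∈ H l
    · obtain ⟨rfl, hv⟩ := hv
      rw [hs.of_mem h v hv]
      refine (abs_wdist_sub_le hX _ _ _).trans ?_
      rw [wdist_comm hX]
      simp [wdist]
    · simp [hs.of_avoid m h v hv]
  | gen x => exact ⟨0, fun l u v₀ s hs v => by simp [hs.gen]⟩
  | one => exact ⟨0, fun l u v₀ s hs v => by simp [hs.isCocycle.map_one]⟩
  | inv a ha =>
    obtain ⟨M, hM⟩ := ha
    refine ⟨M, fun l u v₀ s hs v => ?_⟩
    rw [hs.isCocycle.map_inv, abs_neg]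
    exact hM l u v₀ s hs _
  | mul a b ha hb =>
    obtain ⟨M, hM⟩ := ha
    obtain ⟨N, hN⟩ := hb
    refine ⟨M + N, fun l u v₀ s hs v => ?_⟩
    rw [hs.isCocycle]
    push_cast
    exact (abs_add_le _ _).trans (add_le_add (hM l u v₀ s hs _) (hN l u v₀ s hs _))

/-- Every generator in `X` is represented by a word over `Y ∪ 𝓗` of bounded length. -/
theorem exists_lift (hsurj : Function.Surjective (relEps H Y)) (hX : X.Finite) :
    ∃ (σ : G → List (RelLetter H Y)) (C : ℕ), 1 ≤ C ∧ (∀ a, relEps H Y (wordToF (σ a)) = a) ∧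
      ∀ a, a ∈ X ∨ a⁻¹ ∈ X → (σ a).length ≤ C := by
  have : ∀ a, ∃ W : List (RelLetter H Y), relEps H Y (wordToF W) = a := fun a => by
    obtain ⟨b, rfl⟩ := hsurj a
    obtain ⟨W, rfl⟩ := exists_wordToF_eq b
    exact ⟨W, rfl⟩
  choose σ hσ using this
  obtain ⟨C, hC⟩ := exists_nat_bound (hX.union hX.inv) (P := fun a M => (σ a).length ≤ M)
    (fun a _ => ⟨_, le_rfl⟩) (fun a M N h h' => h'.trans h)
  exact ⟨σ, C + 1, by omega, hσ, fun a ha => (hC a (by simpa using ha)).trans (by omega)⟩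

theorem wordToF_append (V W : List (RelLetter H Y)) :
    wordToF (V ++ W) = wordToF V * wordToF W := by
  simp [wordToF]

/-- An edge path returning to the coset `u * H l` without using edges of that coset ends at
bounded `X`-distance from its origin, linearly in its length. -/
theorem exists_avoidPath_bound (H : Λ → Subgroup G) (hXfin : X.Finite)
    (hX : Subgroup.closure X = ⊤) (hhyp : IsRelHyperbolic H) :
    ∃ K : ℕ, ∀ l u n v w, u⁻¹ * v ∈ H l → u⁻¹ * w ∈ H l → AvoidPath H X l u n v w →
      wdist X v w ≤ K * (n + 1) := by
  obtain ⟨Y, R, pres, A, B, hiso⟩ := hhyp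
  have hker : ∀ r ∈ R, relEps H Y r = 1 := fun r hr => by
    rw [← MonoidHom.mem_ker, pres.ker]; exact Subgroup.subset_normalClosure hr
  obtain ⟨σ, C, hC1, hσ, hC⟩ := exists_lift (X := X) pres.surj hXfin
  have hb := fun a : RelFree H Y => IsCosetCocycle.exists_bound (H := H) hX a
  obtain ⟨MR, hMR⟩ := exists_nat_bound pres.finR (fun a _ => hb a)
    (fun a M N h h' l u v₀ s hs v => (h' l u v₀ s hs v).trans (by exact_mod_cast h))
  obtain ⟨M, hM⟩ := exists_nat_bound (hXfin.union hXfin.inv) (fun a _ => hb (wordToF (σ a)))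
    (fun a M N h h' l u v₀ s hs v => (h' l u v₀ s hs v).trans (by exact_mod_cast h))
  have key : ∀ l u v₀ s, IsCosetCocycle H X Y l u v₀ s → ∀ n v w, AvoidPath H X l u n v w →
      ∃ W : List (RelLetter H Y), relEps H Y (wordToF W) = v⁻¹ * w ∧ W.length ≤ C * n ∧
        |s (wordToF W) v| ≤ M * n := by
    intro l u v₀ s hs n v w hvw
    induction hvw with
    | refl v => exact ⟨[], by simp [wordToF], by simp, by simp [wordToF, hs.isCocycle.map_one]⟩
    | @step n v z w h _ ih =>
      obtain ⟨W, hW, hWC, hWM⟩ := ih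
      suffices ∃ V : List (RelLetter H Y), relEps H Y (wordToF V) = v⁻¹ * z ∧ V.length ≤ C ∧
          |s (wordToF V) v| ≤ M by
        obtain ⟨V, hV, hVC, hVM⟩ := this
        refine ⟨V ++ W, by simp [wordToF_append, hV, hW], by simp; lia, ?_⟩
        rw [wordToF_append, hs.isCocycle, hV, mul_inv_cancel_left]
        push_cast
        linarith [abs_add_le (s (wordToF V) v) (s (wordToF W) z)]
      rcases h with rfl | h | ⟨m, hm, hav⟩
      · exact ⟨[], by simp [wordToF], by simp, by simp [wordToF, hs.isCocycle.map_one]⟩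
      · exact ⟨σ (v⁻¹ * z), hσ _, hC _ h, hM (v⁻¹ * z) (by simpa using h) l u v₀ s hs v⟩
      · obtain ⟨V, hV1, hV⟩ := exists_wordToF_eq_of (Y := Y) m ⟨v⁻¹ * z, hm⟩
        refine ⟨V, by rw [hV, relEps_of], by omega, ?_⟩
        rw [hV, hs.of_avoid m _ v hav]
        simp
  refine ⟨M + MR * (A * (C + 1) + B), fun l u n v w hv hw hvw => ?_⟩
  obtain ⟨s, hs⟩ := exists_isCosetCocycle H X Y l u v
  obtain ⟨W, hW, hWC, hWM⟩ := key l u v s hs n v w hvw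
  have hh : w⁻¹ * v ∈ H l := by
    have := mul_mem (inv_mem hw) hv
    simpa [mul_assoc] using this
  obtain ⟨V, hV1, hV⟩ := exists_wordToF_eq_of (Y := Y) l ⟨w⁻¹ * v, hh⟩
  have hsV : s (wordToF V) w = - (wdist X v w : ℤ) := by
    rw [hV, hs.of_mem _ w hw]; simp
  have htot := hs.isCocycle.abs_wordToF_le hiso hker (fun r hr => hMR r hr l u v s hs) (W ++ V)
    (by simp [wordToF_append, hW, hV, relEps_of, mul_assoc]) v
  rw [wordToF_append, hs.isCocycle, hW, mul_inv_cancel_left, hsV] at htot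
  have hlen : (W ++ V).length ≤ C * n + 1 := by simp; omega
  have h1 : A * (W ++ V).length + B ≤ (A * (C + 1) + B) * (n + 1) := by
    have := Nat.mul_le_mul_left A hlen
    nlinarith [Nat.zero_le (A * C), Nat.zero_le (A * n), Nat.zero_le (B * n)]
  have h2 : ((A * (W ++ V).length + B : ℕ) : ℤ) * MR ≤ ((A * (C + 1) + B) * (n + 1) : ℕ) * MR := by
    gcongr
  rw [abs_le] at htot hWM
  zify
  push_cast at *
  nlinarith [htot.1, hWM.2]

/-- `PathSum S φ ψ n v w I`: the integral of `φ dψ` along some path of length `n` from `v` to `w`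
in the Cayley graph with respect to `S` (allowing constant steps) is `I`. -/
inductive PathSum (S : Set G) (φ ψ : G → ℤ) : ℕ → G → G → ℤ → Prop
  | refl (v : G) : PathSum S φ ψ 0 v v 0
  | step {n : ℕ} {v z w : G} {I : ℤ} (h : wdist S v z ≤ 1) (hzw : PathSum S φ ψ n z w I) :
      PathSum S φ ψ (n + 1) v w (φ v * (ψ z - ψ v) + I)

/-- Functions that are 1-Lipschitz with respect to the word metric. -/
def WLip (S : Set G) (φ : G → ℤ) : Prop := ∀ v w, |φ v - φ w| ≤ wdist S v w

/-- The generating set `X ∪ 𝓗`. -/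
abbrev relGen (H : Λ → Subgroup G) (X : Set G) : Set G := X ∪ ⋃ l, (H l : Set G)

theorem wdist_relGen_le_one {v w : G} {l : Λ} (h : v⁻¹ * w ∈ H l) :
    wdist (relGen H X) v w ≤ 1 :=
  wordLength_le_one (Or.inl (Or.inr (Set.mem_iUnion.2 ⟨l, h⟩)))

/-- The cocycle `s` represents `φ dψ`, up to a bounded error on `H l`-edges. -/
structure IsProdCocycle (φ ψ : G → ℤ) (s : RelFree H Y → G → ℤ) : Prop where
  isCocycle : IsCocycle (relEps H Y) s
  of : ∀ (m : Λ) (h : H m) (v : G),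
    |s (Monoid.Coprod.inl (Monoid.CoprodI.of h)) v - φ v * (ψ (v * h) - ψ v)| ≤ 1
  gen : ∀ (x : Y) (v : G), s (Monoid.Coprod.inr (FreeGroup.of x)) v = φ v * (ψ (v * x) - ψ v)

theorem exists_isProdCocycle (H : Λ → Subgroup G) (X Y : Set G) {φ ψ : G → ℤ}
    (hφ : WLip (relGen H X) φ) (hψ : WLip (relGen H X) ψ) :
    ∃ s : RelFree H Y → G → ℤ, IsProdCocycle φ ψ s := by
  obtain ⟨s, hs, hof, hgen⟩ := exists_isCocycle (H := H) (Y := Y)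
    (fun m v => φ (QuotientGroup.mk (s := H m) v).out * ψ v)
    (fun x v => φ v * (ψ (v * x) - ψ v))
  refine ⟨s, hs, fun m h v => ?_, hgen⟩
  have hq : (QuotientGroup.mk (s := H m) (v * h)) = QuotientGroup.mk (s := H m) v := by
    rw [QuotientGroup.eq]; simp
  rw [hof, hq, ← mul_sub, ← sub_mul, abs_mul]
  have h1 : |φ (QuotientGroup.mk (s := H m) v).out - φ v| ≤ 1 := by
    refine (hφ _ _).trans ?_
    have : wdist (relGen H X) (QuotientGroup.mk (s := H m) v).out v ≤ 1 := by
      refine wdist_relGen_le_one (l := m) ?_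
      rw [← QuotientGroup.eq, QuotientGroup.out_eq']
    exact_mod_cast this
  have h2 : |ψ (v * h) - ψ v| ≤ 1 := by
    refine (hψ _ _).trans ?_
    have : wdist (relGen H X) (v * h) v ≤ 1 := wdist_relGen_le_one (l := m) (by simp)
    exact_mod_cast this
  calc _ ≤ (1 : ℤ) * 1 := mul_le_mul h1 h2 (abs_nonneg _) zero_le_one
    _ = 1 := one_mul 1

theorem IsProdCocycle.exists_bound (hX : Subgroup.closure (relGen H X) = ⊤) (a : RelFree H Y) :
    ∃ M : ℕ, ∀ φ ψ (s : RelFree H Y → G → ℤ), WLip (relGen H X) φ → WLip (relGen H X) ψ →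
      IsProdCocycle φ ψ s → ∀ v, |s a v - φ v * (ψ (v * relEps H Y a) - ψ v)| ≤ M := by
  have lip : ∀ {φ : G → ℤ} (v b : G), WLip (relGen H X) φ →
      |φ (v * b) - φ v| ≤ wordLength (relGen H X) b := by
    intro φ v b hφ
    refine (hφ _ _).trans ?_
    rw [wdist_comm hX]; simp [wdist]
  induction a using relFree_induction with
  | of m h => exact ⟨1, fun φ ψ s _ _ hs v => by simpa [relEps_of] using hs.of m h v⟩
  | gen x => exact ⟨0, fun φ ψ s _ _ hs v => by rw [hs.gen]; simp [relEps]⟩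
  | one => exact ⟨0, fun φ ψ s _ _ hs v => by simp [hs.isCocycle.map_one]⟩
  | inv a ha =>
    obtain ⟨M, hM⟩ := ha
    set L := wordLength (relGen H X) (relEps H Y a)⁻¹ with hL
    refine ⟨M + L * L, fun φ ψ s hφ hψ hs v => ?_⟩
    have h1 := hM φ ψ s hφ hψ hs (v * (relEps H Y a)⁻¹)
    have h2 := lip v (relEps H Y a)⁻¹ hφ
    have h3 := lip v (relEps H Y a)⁻¹ hψ
    have h4 := mul_le_mul h2 h3 (abs_nonneg _) (Int.natCast_nonneg _)
    rw [← abs_mul] at h4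
    rw [hs.isCocycle.map_inv, map_inv]
    rw [inv_mul_cancel_right] at h1
    rw [abs_le] at *
    push_cast
    constructor <;> nlinarith
  | mul a b ha hb =>
    obtain ⟨M, hM⟩ := ha
    obtain ⟨N, hN⟩ := hb
    refine ⟨M + N + wordLength (relGen H X) (relEps H Y a) *
      wordLength (relGen H X) (relEps H Y b), fun φ ψ s hφ hψ hs v => ?_⟩
    have h1 := hM φ ψ s hφ hψ hs v
    have h2 := hN φ ψ s hφ hψ hs (v * relEps H Y a)
    have h3 := mul_le_mul (lip v (relEps H Y a) hφ)
      (lip (v * relEps H Y a) (relEps H Y b) hψ) (abs_nonneg _) (Int.natCast_nonneg _)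
    rw [← abs_mul] at h3
    rw [hs.isCocycle, map_mul, ← mul_assoc]
    rw [abs_le] at *
    push_cast
    constructor <;> nlinarith

/-- The integral of `φ dψ` along a closed path is bounded linearly in the length of the path. -/
theorem exists_pathSum_bound (H : Λ → Subgroup G) (hXfin : X.Finite)
    (hX : Subgroup.closure (relGen H X) = ⊤) (hhyp : IsRelHyperbolic H) :
    ∃ K : ℕ, ∀ φ ψ, WLip (relGen H X) φ → WLip (relGen H X) ψ → ∀ n v I,
      PathSum (relGen H X) φ ψ n v v I → |I| ≤ K * (n + 1) := by
  obtain ⟨Y, R, pres, A, B, hiso⟩ := hhyp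
  have hker : ∀ r ∈ R, relEps H Y r = 1 := fun r hr => by
    rw [← MonoidHom.mem_ker, pres.ker]; exact Subgroup.subset_normalClosure hr
  obtain ⟨σ, C, hC1, hσ, hC⟩ := exists_lift (X := X) pres.surj hXfin
  have hb := fun a : RelFree H Y => IsProdCocycle.exists_bound (H := H) hX a
  obtain ⟨MR, hMR⟩ := exists_nat_bound pres.finR (fun a _ => hb a)
    (fun a M N h h' φ ψ s hφ hψ hs v => (h' φ ψ s hφ hψ hs v).trans (by exact_mod_cast h))
  obtain ⟨M, hM⟩ := exists_nat_bound (hXfin.union hXfin.inv) (fun a _ => hb (wordToF (σ a)))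
    (fun a M N h h' φ ψ s hφ hψ hs v => (h' φ ψ s hφ hψ hs v).trans (by exact_mod_cast h))
  refine ⟨M + 1 + MR * (A * C + B), fun φ ψ hφ hψ => ?_⟩
  obtain ⟨s, hs⟩ := exists_isProdCocycle H X Y hφ hψ
  have key : ∀ n v w I, PathSum (relGen H X) φ ψ n v w I →
      ∃ W : List (RelLetter H Y), relEps H Y (wordToF W) = v⁻¹ * w ∧ W.length ≤ C * n ∧
        |s (wordToF W) v - I| ≤ (M + 1) * n := by
    intro n v w I hvw
    induction hvw with
    | refl v => exact ⟨[], by simp [wordToF], by simp, by simp [wordToF, hs.isCocycle.map_one]⟩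
    | @step n v z w I h _ ih =>
      obtain ⟨W, hW, hWC, hWM⟩ := ih
      suffices ∃ V : List (RelLetter H Y), relEps H Y (wordToF V) = v⁻¹ * z ∧ V.length ≤ C ∧
          |s (wordToF V) v - φ v * (ψ z - ψ v)| ≤ M + 1 by
        obtain ⟨V, hV, hVC, hVM⟩ := this
        refine ⟨V ++ W, by simp [wordToF_append, hV, hW], by simp; lia, ?_⟩
        rw [wordToF_append, hs.isCocycle, hV, mul_inv_cancel_left]
        rw [abs_le] at *
        push_cast
        constructor <;> linarith
      have hX' : v⁻¹ * z ∈ X ∨ (v⁻¹ * z)⁻¹ ∈ X → ∃ V : List (RelLetter H Y),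
          relEps H Y (wordToF V) = v⁻¹ * z ∧ V.length ≤ C ∧
          |s (wordToF V) v - φ v * (ψ z - ψ v)| ≤ M + 1 := by
        intro h
        refine ⟨σ (v⁻¹ * z), hσ _, hC _ h, ?_⟩
        have := hM (v⁻¹ * z) (by simpa using h) φ ψ s hφ hψ hs v
        rw [hσ, mul_inv_cancel_left] at this
        linarith
      have hH' : ∀ m, v⁻¹ * z ∈ H m → ∃ V : List (RelLetter H Y),
          relEps H Y (wordToF V) = v⁻¹ * z ∧ V.length ≤ C ∧
          |s (wordToF V) v - φ v * (ψ z - ψ v)| ≤ M + 1 := by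
        intro m hm
        obtain ⟨V, hV1, hV⟩ := exists_wordToF_eq_of (Y := Y) m ⟨v⁻¹ * z, hm⟩
        refine ⟨V, by rw [hV, relEps_of], by omega, ?_⟩
        have := hs.of m ⟨v⁻¹ * z, hm⟩ v
        rw [mul_inv_cancel_left] at this
        rw [hV]
        linarith
      rcases eq_one_or_mem_of_wordLength_le_one hX h with h | h | h
      · obtain rfl := inv_mul_eq_one.1 h
        refine ⟨[], by simp [wordToF], by simp, ?_⟩
        simp only [wordToF, List.map_nil, List.prod_nil, hs.isCocycle.map_one, sub_self, mul_zero,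
          abs_zero]
        positivity
      · rcases h with h | h
        · exact hX' (Or.inl h)
        · obtain ⟨m, hm⟩ := Set.mem_iUnion.1 h
          exact hH' m hm
      · rcases h with h | h
        · exact hX' (Or.inr h)
        · obtain ⟨m, hm⟩ := Set.mem_iUnion.1 h
          exact hH' m (by simpa using inv_mem hm)
  intro n v I hI
  obtain ⟨W, hW, hWC, hWM⟩ := key n v v I hI
  rw [inv_mul_cancel] at hW
  have htot := hs.isCocycle.abs_wordToF_le hiso hker (M := MR) (fun r hr v => by
    simpa [hker r hr] using hMR r hr φ ψ s hφ hψ hs v) W hW v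
  have h1 : A * W.length + B ≤ (A * C + B) * (n + 1) := by
    have := Nat.mul_le_mul_left A hWC
    nlinarith [Nat.zero_le (A * C), Nat.zero_le (B * n)]
  have h2 : ((A * W.length + B : ℕ) : ℤ) * MR ≤ ((A * C + B) * (n + 1) : ℕ) * MR := by
    gcongr
  rw [abs_le] at *
  push_cast at *
  constructor <;> nlinarith

end Isoperimetry

section AvoidPath

variable {G : Type*} [Group G] {Λ : Type*} {H : Λ → Subgroup G} {X : Set G} {l : Λ}
  {u v w z : G} {m n : ℕ}

theorem closure_relGen (hX : Subgroup.closure X = ⊤) : Subgroup.closure (relGen H X) = ⊤ :=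
  top_le_iff.1 (hX ▸ Subgroup.closure_mono Set.subset_union_left)

theorem AvoidPath.single (h : v = z ∨ (v⁻¹ * z ∈ X ∨ (v⁻¹ * z)⁻¹ ∈ X) ∨
      ∃ m, v⁻¹ * z ∈ H m ∧ ¬ (m = l ∧ u⁻¹ * v ∈ H l)) : AvoidPath H X l u 1 v z :=
  .step h (.refl z)

theorem AvoidPath.trans (h₁ : AvoidPath H X l u m v w) (h₂ : AvoidPath H X l u n w z) :
    AvoidPath H X l u (m + n) v z := by
  induction h₁ with
  | refl v => simpa using h₂
  | @step m _ _ _ h _ ih => rw [Nat.add_right_comm]; exact .step h (ih h₂)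

theorem AvoidPath.mono (h : AvoidPath H X l u m v w) (hmn : m ≤ n) : AvoidPath H X l u n v w := by
  induction hmn with
  | refl => exact h
  | step _ ih => exact .step (Or.inl rfl) ih

theorem AvoidPath.symm (h : AvoidPath H X l u n v w) : AvoidPath H X l u n w v := by
  induction h with
  | refl v => exact .refl v
  | @step n v z w h _ ih =>
    refine ih.trans (.single ?_)
    rcases h with h | h | ⟨m, hm, hav⟩
    · exact Or.inl h.symm
    · exact Or.inr (Or.inl (by simpa using h.symm))
    · refine Or.inr (Or.inr ⟨m, by simpa using inv_mem hm, fun h => hav ⟨h.1, ?_⟩⟩)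
      obtain ⟨rfl, h⟩ := h
      simpa [mul_assoc] using mul_mem h (inv_mem hm)

theorem AvoidPath.mul_left (h : AvoidPath H X l u n v w) (c : G) :
    AvoidPath H X l (c * u) n (c * v) (c * w) := by
  induction h with
  | refl v => exact .refl _
  | step h _ ih => exact .step (by simpa [mul_assoc] using h) ih

theorem AvoidPath.of_mem {u' : G} (hu : u⁻¹ * u' ∈ H l) (h : AvoidPath H X l u n v w) :
    AvoidPath H X l u' n v w := by
  induction h with
  | refl v => exact .refl _
  | step h _ ih =>
    refine .step ?_ ih
    refine h.imp_right (Or.imp_right fun ⟨m, hm, hav⟩ => ⟨m, hm, fun h => hav ⟨h.1, ?_⟩⟩)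
    simpa [mul_assoc] using mul_mem hu h.2

theorem avoidPath_of_wdist (hX : Subgroup.closure X = ⊤) (v w : G) :
    AvoidPath H X l u (wdist X v w) v w := by
  obtain ⟨L, hL, hLX, hprod⟩ := exists_word hX (v⁻¹ * w)
  rw [wdist, ← hL]
  clear hL
  induction L generalizing v with
  | nil =>
    obtain rfl := inv_mul_eq_one.1 hprod.symm
    exact .refl v
  | cons a L ih =>
    refine .step (z := v * a) (Or.inr (Or.inl (by simpa using hLX a (by simp)))) (ih _ ?_ ?_)
    · exact fun x hx => hLX x (by simp [hx])
    · rw [List.prod_cons] at hprod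
      rw [mul_inv_rev, mul_assoc, ← hprod, inv_mul_cancel_left]

theorem AvoidPath.wdist_le (hX : Subgroup.closure X = ⊤) (h : AvoidPath H X l u n v w) :
    wdist (relGen H X) v w ≤ n := by
  induction h with
  | refl v => simp
  | @step n v z w h _ ih =>
    refine (wdist_triangle (closure_relGen hX) v z w).trans ?_
    suffices wdist (relGen H X) v z ≤ 1 by omega
    rcases h with rfl | h | ⟨m, hm, -⟩
    · simp
    · exact wordLength_le_one (h.imp Or.inl Or.inl)
    · exact wdist_relGen_le_one hm

theorem wdist_relGen_le (hX : Subgroup.closure X = ⊤) (v w : G) :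
    wdist (relGen H X) v w ≤ wdist X v w := by
  obtain ⟨L, hL, hLX, hprod⟩ := exists_word hX (v⁻¹ * w)
  rw [wdist, wdist, ← hL, ← hprod]
  exact wordLength_le fun x hx => (hLX x hx).imp Or.inl Or.inl

/-- The `i`-th step of the path `p` joins two elements of the coset `u * H l`. -/
def HasEdge (H : Λ → Subgroup G) (l : Λ) (u : G) (p : ℕ → G) (i : ℕ) : Prop :=
  u⁻¹ * p i ∈ H l ∧ u⁻¹ * p (i + 1) ∈ H l

theorem wdist_le_one_of_mem (hv : u⁻¹ * v ∈ H l) (hw : u⁻¹ * w ∈ H l) :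
    wdist (relGen H X) v w ≤ 1 :=
  wdist_relGen_le_one (l := l) (by simpa [mul_assoc] using mul_mem (inv_mem hv) hw)

theorem Geo.eq_of_hasEdge (hX : Subgroup.closure X = ⊤) {p : ℕ → G}
    (hp : Geo (relGen H X) p n) {i j : ℕ} (hi : i < n) (hj : j < n) (hpi : HasEdge H l u p i)
    (hpj : HasEdge H l u p j) : i = j := by
  have h1 := wdist_le_one_of_mem (X := X) hpi.1 hpj.2
  have h2 := wdist_le_one_of_mem (X := X) hpi.2 hpj.1
  have h3 := hp.wdist_eq (closure_relGen hX) (i := i) (j := j + 1) (by omega) (by omega)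
  have h4 := hp.wdist_eq (closure_relGen hX) (i := i + 1) (j := j) (by omega) (by omega)
  have h5 := le_abs_self ((i : ℤ) - (j + 1 : ℕ))
  have h6 := neg_abs_le ((i : ℤ) - (j + 1 : ℕ))
  have h7 := le_abs_self (((i + 1 : ℕ) : ℤ) - j)
  have h8 := neg_abs_le (((i + 1 : ℕ) : ℤ) - j)
  omega

theorem avoidPath_of_wdist_le_one (hX : Subgroup.closure X = ⊤)
    (h : wdist (relGen H X) v w ≤ 1) (h' : ¬ (u⁻¹ * v ∈ H l ∧ u⁻¹ * w ∈ H l)) :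
    AvoidPath H X l u 1 v w := by
  refine .single ?_
  have hH : (∃ m, v⁻¹ * w ∈ H m) → ∃ m, v⁻¹ * w ∈ H m ∧ ¬ (m = l ∧ u⁻¹ * v ∈ H l) := by
    rintro ⟨m, hm⟩
    refine ⟨m, hm, ?_⟩
    rintro ⟨rfl, hv⟩
    exact h' ⟨hv, by simpa [mul_assoc] using mul_mem hv hm⟩
  rcases eq_one_or_mem_of_wordLength_le_one (closure_relGen hX) h with h | h | h
  · exact Or.inl (inv_mul_eq_one.1 h)
  · rcases h with h | h
    · exact Or.inr (Or.inl (Or.inl h))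
    · exact Or.inr (Or.inr (hH (Set.mem_iUnion.1 h)))
  · rcases h with h | h
    · exact Or.inr (Or.inl (Or.inr h))
    · obtain ⟨m, hm⟩ := Set.mem_iUnion.1 h
      exact Or.inr (Or.inr (hH ⟨m, by simpa using inv_mem hm⟩))

theorem exists_mem_of_one_lt_wdist (hX : Subgroup.closure X = ⊤)
    (h : wdist (relGen H X) v w ≤ 1) (h' : 1 < wdist X v w) : ∃ m, v⁻¹ * w ∈ H m := by
  have hX1 : v⁻¹ * w ∈ X ∨ (v⁻¹ * w)⁻¹ ∈ X → ∃ m, v⁻¹ * w ∈ H m := fun h =>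
    absurd (wordLength_le_one h) h'.not_ge
  rcases eq_one_or_mem_of_wordLength_le_one (closure_relGen hX) h with h | h | h
  · simp [wdist, h] at h'
  · rcases h with h | h
    exacts [hX1 (Or.inl h), Set.mem_iUnion.1 h]
  · rcases h with h | h
    · exact hX1 (Or.inr h)
    · obtain ⟨m, hm⟩ := Set.mem_iUnion.1 h
      exact ⟨m, by simpa using inv_mem hm⟩

theorem Geo.avoidPath (hX : Subgroup.closure X = ⊤) {p : ℕ → G} (hp : Geo (relGen H X) p n)
    {i j : ℕ} (hij : i ≤ j) (hj : j ≤ n) (h : ∀ k, i ≤ k → k < j → ¬ HasEdge H l u p k) :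
    AvoidPath H X l u (j - i) (p i) (p j) := by
  induction j, hij using Nat.le_induction with
  | base => simpa using AvoidPath.refl (p i)
  | succ j hij ih =>
    have h1 := ih (by omega) fun k hk hkj => h k hk (by omega)
    have h2 : AvoidPath H X l u 1 (p j) (p (j + 1)) :=
      avoidPath_of_wdist_le_one hX (by rw [hp j (j + 1) (by omega) hj]; omega)
        (h j hij (by omega))
    exact (h1.trans h2).mono (by omega)

/-- A geodesic far away from a coset avoids it. -/
theorem avoidPath_of_far (hX : Subgroup.closure X = ⊤) (hz : u⁻¹ * z ∈ H l)
    (h : wdist (relGen H X) v w + 1 < wdist (relGen H X) z v) :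
    AvoidPath H X l u (wdist (relGen H X) v w) v w := by
  obtain ⟨c, hc0, hc1, hc⟩ := exists_geo (closure_relGen (H := H) hX) v w
  have := hc.avoidPath (l := l) (u := u) hX (Nat.zero_le _) le_rfl fun k _ hk hedge => by
    have h1 := wdist_le_one_of_mem (X := X) hz hedge.1
    have h2 := wdist_triangle (closure_relGen (H := H) hX) z (c k) v
    have h3 := hc 0 k (by omega) (by omega)
    rw [hc0, wdist_comm (closure_relGen (H := H) hX)] at h3
    omega
  simpa [hc0, hc1] using this

end AvoidPath

section FellowTravel

variable {G : Type*} [Group G] {Λ : Type*} {S : Set G} {φ ψ : G → ℤ}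

theorem PathSum.trans {m n : ℕ} {v w z : G} {I J : ℤ} (h₁ : PathSum S φ ψ m v w I)
    (h₂ : PathSum S φ ψ n w z J) : PathSum S φ ψ (m + n) v z (I + J) := by
  induction h₁ with
  | refl v => simpa using h₂
  | step h _ ih => rw [Nat.add_right_comm, add_assoc (φ _ * _)]; exact .step h (ih h₂)

theorem pathSum_of_seq {c : ℕ → G} {n : ℕ} (h : ∀ i < n, wdist S (c i) (c (i + 1)) ≤ 1) :
    PathSum S φ ψ n (c 0) (c n)
      (∑ i ∈ Finset.range n, φ (c i) * (ψ (c (i + 1)) - ψ (c i))) := by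
  induction n with
  | zero => exact .refl _
  | succ n ih =>
    rw [Finset.sum_range_succ]
    refine (ih fun i hi => h i (by omega)).trans ?_
    simpa using PathSum.step (φ := φ) (ψ := ψ) (h n (by omega)) (.refl (c (n + 1)))

theorem exists_pathSum_le (hS : Subgroup.closure S = ⊤) (hψ : WLip S ψ) {s : ℕ}
    (hφ : ∀ v, |φ v| ≤ s) (v w : G) :
    ∃ I, PathSum S φ ψ (wdist S v w) v w I ∧ |I| ≤ s * wdist S v w := by
  obtain ⟨c, hc0, hc1, hc⟩ := exists_geo hS v w
  have hstep : ∀ i < wdist S v w, wdist S (c i) (c (i + 1)) ≤ 1 := fun i hi => by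
    rw [hc i (i + 1) (by omega) (by omega)]; omega
  have h := pathSum_of_seq (φ := φ) (ψ := ψ) hstep
  rw [hc0, hc1] at h
  refine ⟨_, h, (Finset.abs_sum_le_sum_abs _ _).trans ?_⟩
  refine (Finset.sum_le_card_nsmul _ _ (s : ℤ) fun i hi => ?_).trans
    (by simp [mul_comm])
  rw [abs_mul]
  have h1 : |ψ (c (i + 1)) - ψ (c i)| ≤ 1 := by
    refine (hψ _ _).trans ?_
    rw [wdist_comm hS]
    exact_mod_cast hstep i (Finset.mem_range.1 hi)
  calc _ ≤ (s : ℤ) * 1 := mul_le_mul (hφ _) h1 (abs_nonneg _) (by positivity)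
    _ = s := mul_one _

theorem Geo.pathSum_zero (hS : Subgroup.closure S = ⊤) {q : ℕ → G} {n : ℕ} (hq : Geo S q n)
    (hφ : ∀ i ≤ n, φ (q i) = 0) {i j : ℕ} (hi : i ≤ n) (hj : j ≤ n) :
    PathSum S φ ψ (wdist S (q i) (q j)) (q i) (q j) 0 := by
  rcases le_total i j with h | h
  · have := pathSum_of_seq (S := S) (φ := φ) (ψ := ψ) (c := fun t => q (i + t)) (n := j - i)
      fun t ht => by rw [hq _ _ (by omega) (by omega)]; omega
    rw [Finset.sum_eq_zero fun t ht => by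
      rw [hφ _ (by have := Finset.mem_range.1 ht; omega), zero_mul]] at this
    simpa [hq i j h hj, h] using this
  · have := pathSum_of_seq (S := S) (φ := φ) (ψ := ψ) (c := fun t => q (i - t)) (n := i - j)
      fun t ht => by rw [wdist_comm hS, hq _ _ (by omega) (by omega)]; omega
    rw [Finset.sum_eq_zero fun t ht => by rw [hφ _ (by omega), zero_mul]] at this
    rw [wdist_comm hS, hq j i h hi]
    simpa [Nat.sub_sub_self h] using this

theorem exists_dist_to_geo (S : Set G) (q : ℕ → G) (n : ℕ) :
    ∃ δ : G → ℕ, (∀ v, ∀ j ≤ n, δ v ≤ wdist S v (q j)) ∧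
      ∀ v, ∃ j ≤ n, δ v = wdist S v (q j) := by
  have : ∀ v, ∃ d, (∀ j ≤ n, d ≤ wdist S v (q j)) ∧ ∃ j ≤ n, d = wdist S v (q j) := fun v => by
    obtain ⟨j, hj, hmin⟩ := Finset.exists_min_image (Finset.range (n + 1))
      (fun j => wdist S v (q j)) ⟨0, by simp⟩
    exact ⟨_, fun i hi => hmin i (by simp; omega), j, by simp at hj; omega, rfl⟩
  choose δ h1 h2 using this
  exact ⟨δ, h1, h2⟩

theorem exists_last_le {P : ℕ → Prop} {i : ℕ} (h0 : P 0) :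
    ∃ j ≤ i, P j ∧ ∀ t, j < t → t ≤ i → ¬ P t := by
  classical
  exact ⟨Nat.findGreatest P i, Nat.findGreatest_le i, Nat.findGreatest_spec (Nat.zero_le i) h0,
    fun t h1 h2 => Nat.findGreatest_is_greatest h1 h2⟩

theorem exists_first_ge {P : ℕ → Prop} {i n : ℕ} (hi : i ≤ n) (hn : P n) :
    ∃ j, i ≤ j ∧ j ≤ n ∧ P j ∧ ∀ t, i ≤ t → t < j → ¬ P t := by
  classical
  have h : ∃ j, i ≤ j ∧ P j := ⟨n, hi, hn⟩
  exact ⟨Nat.find h, (Nat.find_spec h).1, Nat.find_min' h ⟨hi, hn⟩, (Nat.find_spec h).2,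
    fun t h1 h2 h3 => Nat.find_min h h2 ⟨h1, h3⟩⟩

/-- Geodesics with nearby endpoints are uniformly close to each other, provided that `S` satisfies
a linear isoperimetric inequality for the integrals of `φ dψ`. -/
theorem exists_fellowTravel (hS : Subgroup.closure S = ⊤) {K : ℕ}
    (hK : ∀ φ ψ, WLip S φ → WLip S ψ → ∀ n v I, PathSum S φ ψ n v v I → |I| ≤ K * (n + 1))
    (k : ℕ) : ∃ D, ∀ p a q b, Geo S p a → Geo S q b → wdist S (p 0) (q 0) ≤ k →
      wdist S (p a) (q b) ≤ k → ∀ i ≤ a, ∃ j ≤ b, wdist S (p i) (q j) ≤ D := by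
  obtain ⟨s, hsk, hsK, hs1⟩ : ∃ s, k ≤ s ∧ 4 * K ≤ s ∧ 1 ≤ s := ⟨k + 4 * K + 1, by omega⟩
  refine ⟨7 * s + 2, fun p a q b hp hq h0 h1 i hi => ?_⟩
  obtain ⟨δ, hδ, hδ'⟩ := exists_dist_to_geo S q b
  suffices δ (p i) ≤ 7 * s + 2 by
    obtain ⟨j, hj, h⟩ := hδ' (p i)
    exact ⟨j, hj, h ▸ this⟩
  have hlip : ∀ v w, δ v ≤ δ w + wdist S v w := fun v w => by
    obtain ⟨j, hj, h⟩ := hδ' w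
    have h2 := hδ v j hj
    have h3 := wdist_triangle hS v w (q j)
    omega
  by_cases his : δ (p i) ≤ s
  · omega
  obtain ⟨i₁, hi1, hP1, hgt1⟩ := exists_last_le (P := fun t => δ (p t) ≤ s) (i := i)
    ((hδ _ 0 (Nat.zero_le _)).trans (h0.trans hsk))
  obtain ⟨i₂, hi2, hi2a, hP2, hgt2⟩ := exists_first_ge (P := fun t => δ (p t) ≤ s) hi
    ((hδ _ b le_rfl).trans (h1.trans hsk))
  have hne1 : i₁ ≠ i := by rintro rfl; exact his hP1
  have hge : ∀ t, i₁ ≤ t → t < i₂ → s ≤ δ (p t) := by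
    intro t ht1 ht2
    by_cases h : t ≤ i
    · rcases ht1.eq_or_lt with rfl | h'
      · have h2 := hgt1 (i₁ + 1) (by omega) (by omega)
        have h3 := hlip (p (i₁ + 1)) (p i₁)
        rw [wdist_comm hS, hp i₁ (i₁ + 1) (by omega) (by omega)] at h3
        omega
      · have := hgt1 t h' h
        omega
    · have := hgt2 t (by omega) ht2
      omega
  set φ : G → ℤ := fun v => (min (δ v) s : ℕ) with hφdef
  set ψ : G → ℤ := fun v => wdist S (p i₁) v with hψdef
  have hφ : WLip S φ := fun v w => by
    have h2 := hlip v w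
    have h3 := hlip w v
    rw [wdist_comm hS] at h3
    rw [abs_le]
    simp only [hφdef]
    constructor <;> omega
  have hψ : WLip S ψ := abs_wdist_sub_le hS _
  have hφs : ∀ v, |φ v| ≤ s := fun v => by simp [hφdef, abs_of_nonneg]
  obtain ⟨j₁, hj1, hd1⟩ := hδ' (p i₁)
  obtain ⟨j₂, hj2, hd2⟩ := hδ' (p i₂)
  have hA : PathSum S φ ψ (i₂ - i₁) (p i₁) (p i₂) (s * (i₂ - i₁ : ℕ)) := by
    have h := pathSum_of_seq (S := S) (φ := φ) (ψ := ψ) (c := fun t => p (i₁ + t))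
      (n := i₂ - i₁) fun t ht => by rw [hp _ _ (by omega) (by omega)]; omega
    rw [Finset.sum_congr rfl (g := fun t : ℕ => (s : ℤ) * (((t + 1 : ℕ) : ℤ) - (t : ℤ)))] at h
    · rw [← Finset.mul_sum, Finset.sum_range_sub (f := fun t : ℕ => (t : ℤ))] at h
      have e : i₁ + (i₂ - i₁) = i₂ := by omega
      simpa [e] using h
    · intro t ht
      rw [Finset.mem_range] at ht
      have e1 : φ (p (i₁ + t)) = s := by
        simp only [hφdef]
        rw [min_eq_right (hge _ (by omega) (by omega))]
      simp only [e1, hψdef]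
      rw [hp _ _ (by omega) (by omega), hp _ _ (by omega) (by omega)]
      congr 2 <;> congr 1 <;> omega
  obtain ⟨IB, hB, hIB⟩ := exists_pathSum_le hS hψ hφs (p i₂) (q j₂)
  have hC : PathSum S φ ψ (wdist S (q j₂) (q j₁)) (q j₂) (q j₁) 0 :=
    hq.pathSum_zero hS (fun t ht => by
      have := hδ (q t) t ht
      rw [wdist_self] at this
      simp only [hφdef]
      omega) hj2 hj1
  obtain ⟨ID, hD, hID⟩ := exists_pathSum_le hS hψ hφs (q j₁) (p i₁)
  have hloop := hK φ ψ hφ hψ _ _ _ (((hA.trans hB).trans hC).trans hD)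
  rw [wdist_comm hS (q j₁)] at hID hloop
  have hC' : wdist S (q j₂) (q j₁) ≤ (i₂ - i₁) + 2 * s := by
    have h2 := wdist_triangle hS (q j₂) (p i₂) (q j₁)
    have h3 := wdist_triangle hS (p i₂) (p i₁) (q j₁)
    rw [wdist_comm hS (p i₂) (p i₁), hp i₁ i₂ (by omega) hi2a] at h3
    rw [wdist_comm hS (q j₂) (p i₂)] at h2
    omega
  have hLi := hlip (p i) (p i₁)
  rw [wdist_comm hS, hp i₁ i (by omega) hi] at hLi
  obtain ⟨L, hL⟩ : ∃ L, L = i₂ - i₁ := ⟨_, rfl⟩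
  suffices L ≤ 6 * s + 2 by omega
  rw [← hL] at hloop hC'
  rw [← hd2] at hIB hloop
  rw [← hd1] at hID hloop
  have hcount : K * (L + δ (p i₂) + wdist S (q j₂) (q j₁) + δ (p i₁) + 1) ≤
      K * (2 * L + 4 * s + 1) := Nat.mul_le_mul_left K (by omega)
  have hB2 : s * δ (p i₂) ≤ s * s := Nat.mul_le_mul_left s hP2
  have hD2 : s * δ (p i₁) ≤ s * s := Nat.mul_le_mul_left s hP1
  rw [abs_le] at hloop hIB hID
  zify at hcount hB2 hD2 hsK hs1 ⊢
  push_cast at *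
  by_contra! hcon
  have hmain : (s : ℤ) * L - 2 * (s * s) ≤ K * (2 * L + 4 * s + 1) := by
    linarith [hloop.2, hIB.1, hID.1]
  nlinarith [mul_nonneg (sub_nonneg.2 hsK) (by positivity : (0 : ℤ) ≤ 2 * L + 4 * s + 1),
    mul_nonneg (sub_nonneg.2 hs1) (sub_nonneg.2 hcon.le),
    mul_pos (lt_of_lt_of_le one_pos hs1) (sub_pos.2 hcon)]

end FellowTravel

section CosetPenetration

variable {G : Type*} [Group G] {Λ : Type*} {H : Λ → Subgroup G} {X : Set G} {l : Λ}
  {u v w z : G} {K n : ℕ}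

/-- Paths returning to a coset of `H l` without using its edges have endpoints at `X`-distance
bounded linearly in their length. -/
def CosetBound (H : Λ → Subgroup G) (X : Set G) (K : ℕ) : Prop :=
  ∀ l u n v w, u⁻¹ * v ∈ H l → u⁻¹ * w ∈ H l → AvoidPath H X l u n v w →
    wdist X v w ≤ K * (n + 1)

/-- Geodesics with nearby endpoints are uniformly close. -/
def FellowTravel (S : Set G) : Prop :=
  ∀ k, ∃ D, ∀ p a q b, Geo S p a → Geo S q b → wdist S (p 0) (q 0) ≤ k →
      wdist S (p a) (q b) ≤ k → ∀ i ≤ a, ∃ j ≤ b, wdist S (p i) (q j) ≤ D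

theorem CosetBound.le (hK : CosetBound H X K) (hv : u⁻¹ * v ∈ H l) (hw : u⁻¹ * w ∈ H l)
    {N : ℕ} (h : AvoidPath H X l u n v w) (hn : n ≤ N) : wdist X v w ≤ K * (N + 1) :=
  (hK l u n v w hv hw h).trans (Nat.mul_le_mul_left K (by omega))

theorem HasEdge.reverse {p : ℕ → G} {a j : ℕ} (hj : j < a) (h : HasEdge H l u p j) :
    HasEdge H l u (fun i => p (a - i)) (a - 1 - j) := by
  refine ⟨?_, ?_⟩
  · simpa [show a - (a - 1 - j) = j + 1 by omega] using h.2
  · simpa [show a - (a - 1 - j + 1) = j by omega] using h.1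

theorem exists_connector (hX : Subgroup.closure X = ⊤) (hF : FellowTravel (relGen H X)) (k : ℕ) :
    ∃ N, ∀ l u p a q b, Geo (relGen H X) p a → Geo (relGen H X) q b →
      AvoidPath H X l u k (p 0) (q 0) → wdist (relGen H X) (p a) (q b) ≤ k →
      ∀ j < a, HasEdge H l u p j →
        ∃ i ≤ b, (i = 0 ∨ i + k + 1 ≤ j) ∧ AvoidPath H X l u N (p j) (q i) := by
  have hS := closure_relGen (H := H) hX
  obtain ⟨D, hD⟩ := hF k
  refine ⟨3 * D + 3 * k + 3, fun l u p a q b hp hq h0 h1 j hj hedge => ?_⟩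
  have hback : ∀ i ≤ j, AvoidPath H X l u (j - i) (p j) (p i) := fun i hi =>
    (hp.avoidPath hX hi hj.le fun t _ ht hpt =>
      ht.ne (hp.eq_of_hasEdge hX (by omega) hj hpt hedge)).symm
  by_cases hjN : j < 2 * D + 2 * k + 3
  · exact ⟨0, Nat.zero_le _, Or.inl rfl, ((hback 0 (Nat.zero_le _)).trans h0).mono (by omega)⟩
  · obtain ⟨N, hN⟩ : ∃ N, N = 2 * D + 2 * k + 3 := ⟨_, rfl⟩
    have h0' := h0.wdist_le hX
    obtain ⟨i, hi, hd⟩ := hD p a q b hp hq h0' h1 (j - N) (by omega)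
    refine ⟨i, hi, Or.inr ?_, ((hback (j - N) (by omega)).trans
      (avoidPath_of_far hX hedge.1 ?_)).mono (by omega)⟩
    · have e1 := wdist_triangle hS (q 0) (p 0) (q i)
      have e2 := wdist_triangle hS (p 0) (p (j - N)) (q i)
      rw [wdist_comm hS (q 0) (p 0), hq 0 i (by omega) hi] at e1
      rw [hp 0 (j - N) (by omega) (by omega)] at e2
      omega
    · rw [wdist_comm hS (p j), hp (j - N) j (by omega) hj.le]
      omega

theorem exists_entry_bound (hX : Subgroup.closure X = ⊤) (hK : CosetBound H X K)
    (hF : FellowTravel (relGen H X)) (k : ℕ) :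
    ∃ T, ∀ l u p a q b, Geo (relGen H X) p a → Geo (relGen H X) q b →
      AvoidPath H X l u k (p 0) (q 0) → wdist (relGen H X) (p a) (q b) ≤ k →
      ∀ j < a, ∀ i < b, HasEdge H l u p j → HasEdge H l u q i → wdist X (p j) (q i) ≤ T := by
  have hS := closure_relGen (H := H) hX
  obtain ⟨N, hN⟩ := exists_connector hX hF k
  refine ⟨K * (2 * N + 1 + 1), fun l u p a q b hp hq h0 h1 j hj i hi hpj hqi => ?_⟩
  obtain ⟨t, ht, htj, hconn⟩ := hN l u p a q b hp hq h0 h1 j hj hpj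
  have hd : wdist (relGen H X) (p j) (q i) ≤ 1 := wdist_le_one_of_mem hpj.1 hqi.1
  have hti : t ≤ i := by
    have e1 := wdist_triangle hS (p 0) (q 0) (q i)
    have e2 := wdist_triangle hS (p 0) (q i) (p j)
    rw [wdist_comm hS (q i) (p j), hp 0 j (by omega) hj.le] at e2
    rw [hq 0 i (by omega) hi.le] at e1
    have := h0.wdist_le hX
    omega
  have hq' : AvoidPath H X l u (i - t) (q t) (q i) := hq.avoidPath hX hti hi.le
    fun s _ hs hqs => hs.ne (hq.eq_of_hasEdge hX (by omega) hi hqs hqi)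
  refine hK.le hpj.1 hqi.1 (hconn.trans hq') ?_
  have e1 := wdist_triangle hS (q t) (p j) (q i)
  rw [wdist_comm hS (q t) (p j), hq t i hti hi.le] at e1
  have := hconn.wdist_le hX
  omega

/-- Bounded coset penetration. -/
theorem exists_coset_penetration (hX : Subgroup.closure X = ⊤) (hK : CosetBound H X K)
    (hF : FellowTravel (relGen H X)) (k : ℕ) :
    ∃ T, ∀ l u p a q b, Geo (relGen H X) p a → Geo (relGen H X) q b →
      AvoidPath H X l u k (p 0) (q 0) → AvoidPath H X l u k (p a) (q b) →
      ∀ j < a, HasEdge H l u p j → T < wdist X (p j) (p (j + 1)) →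
        ∃ i < b, HasEdge H l u q i ∧ wdist X (p j) (q i) ≤ T ∧
          wdist X (p (j + 1)) (q (i + 1)) ≤ T := by
  have hS := closure_relGen (H := H) hX
  obtain ⟨N, hN⟩ := exists_connector hX hF k
  obtain ⟨T, hT⟩ := exists_entry_bound hX hK hF k
  refine ⟨T + K * (4 * N + 1 + 1), fun l u p a q b hp hq h0 h1 j hj hpj hlong => ?_⟩
  have hp' := hp.reverse hS
  have hq' := hq.reverse hS
  have h0' : AvoidPath H X l u k (p (a - 0)) (q (b - 0)) := h1
  have h1' : wdist (relGen H X) (p (a - a)) (q (b - b)) ≤ k := by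
    simpa using h0.wdist_le hX
  have ej : a - (a - 1 - j) = j + 1 := by omega
  by_cases hex : ∃ i < b, HasEdge H l u q i
  · obtain ⟨i, hi, hqi⟩ := hex
    refine ⟨i, hi, hqi, ?_, ?_⟩
    · have := hT l u p a q b hp hq h0 (h1.wdist_le hX) j hj i hi hpj hqi
      omega
    · have := hT l u _ a _ b hp' hq' h0' h1' (a - 1 - j) (by omega) (b - 1 - i) (by omega)
        (hpj.reverse hj) (hqi.reverse hi)
      rw [ej, show b - (b - 1 - i) = i + 1 by omega] at this
      omega
  · push Not at hex
    obtain ⟨s, hs, -, hconn⟩ := hN l u p a q b hp hq h0 (h1.wdist_le hX) j hj hpj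
    obtain ⟨t, -, -, hconn'⟩ := hN l u _ a _ b hp' hq' h0' h1' (a - 1 - j) (by omega)
      (hpj.reverse hj)
    rw [ej] at hconn'
    obtain ⟨r, hr, hrt⟩ : ∃ r ≤ b, r = b - t := ⟨_, by omega, rfl⟩
    rw [← hrt] at hconn'
    have hmid : AvoidPath H X l u (wdist (relGen H X) (q s) (q r)) (q s) (q r) := by
      rcases le_total s r with h | h
      · rw [hq s r h hr]
        exact hq.avoidPath hX h hr fun i _ hi => hex i (by omega)
      · rw [wdist_comm hS, hq r s h hs]
        exact (hq.avoidPath hX h hs fun i _ hi => hex i (by omega)).symm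
    have := hK.le hpj.1 hpj.2 ((hconn.trans hmid).trans hconn'.symm) (N := 4 * N + 1) (by
      have e1 := wdist_triangle hS (q s) (p j) (q r)
      have e2 := wdist_triangle hS (p j) (p (j + 1)) (q r)
      rw [wdist_comm hS (q s) (p j)] at e1
      rw [hp j (j + 1) (by omega) hj] at e2
      have := hconn.wdist_le hX
      have := hconn'.wdist_le hX
      omega)
    omega

end CosetPenetration

section Translates

variable {G : Type*} [Group G] {Λ : Type*} {H : Λ → Subgroup G} {X : Set G} {l : Λ}
  {u g : G} {p : ℕ → G} {K T k n i j : ℕ}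

/-- The `i`-th edge of `p` stays close to the image under `g` of the `j`-th edge of `p`, which
lies in the coset `u * H l`. -/
structure EdgeLink (H : Λ → Subgroup G) (X : Set G) (l : Λ) (T : ℕ) (p : ℕ → G) (u g : G)
    (j i : ℕ) : Prop where
  left : HasEdge H l u p j
  right : HasEdge H l (g * u) p i
  entry : wdist X (g * p j) (p i) ≤ T
  exit : wdist X (g * p (j + 1)) (p (i + 1)) ≤ T

theorem HasEdge.mul_left_iff (c : G) :
    HasEdge H l u (fun i => c * p i) i ↔ HasEdge H l (c⁻¹ * u) p i := by
  simp [HasEdge, mul_assoc]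

theorem wdist_mul_left_eq (S : Set G) (c v w : G) :
    wdist S (c * v) w = wdist S v (c⁻¹ * w) := by
  rw [← wdist_mul_left c⁻¹, inv_mul_cancel_left]

theorem EdgeLink.inv (hX : Subgroup.closure X = ⊤) (h : EdgeLink H X l T p u g j i) :
    EdgeLink H X l T p (g * u) g⁻¹ i j := by
  refine ⟨h.right, by simpa using h.left, ?_, ?_⟩
  · rw [wdist_mul_left_eq, inv_inv, wdist_comm hX]; exact h.entry
  · rw [wdist_mul_left_eq, inv_inv, wdist_comm hX]; exact h.exit

theorem wdist_le_of_close (hX : Subgroup.closure X = ⊤) {a b a' b' : G}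
    (ha : wdist X a a' ≤ T) (hb : wdist X b b' ≤ T) : wdist X a b ≤ wdist X a' b' + 2 * T := by
  have e1 := wdist_triangle hX a a' b
  have e2 := wdist_triangle hX a' b' b
  rw [wdist_comm hX b' b] at e2
  omega

theorem EdgeLink.wdist_le (hX : Subgroup.closure X = ⊤) (h : EdgeLink H X l T p u g j i) :
    wdist X (p j) (p (j + 1)) ≤ wdist X (p i) (p (i + 1)) + 2 * T := by
  simpa using wdist_le_of_close hX h.entry h.exit

theorem EdgeLink.ne (hg : ∀ v, v⁻¹ * g * v ∉ H l) (h : EdgeLink H X l T p u g j i) : j ≠ i := by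
  rintro rfl
  have h1 := h.left.1
  have h2 := h.right.1
  exact hg u (by simpa [mul_assoc] using mul_mem h1 (inv_mem h2))

theorem EdgeLink.index_le (hX : Subgroup.closure X = ⊤) (hp : Geo (relGen H X) p n)
    (h0 : wdist X (p 0) (g * p 0) ≤ k) (hj : j ≤ n) (hi : i ≤ n)
    (h : EdgeLink H X l T p u g j i) : i ≤ j + (k + T) ∧ j ≤ i + (k + T) := by
  have hS := closure_relGen (H := H) hX
  have e0 := (wdist_relGen_le (H := H) hX _ _).trans h0
  have e1 := (wdist_relGen_le (H := H) hX _ _).trans h.entry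
  have e2 := wdist_triangle hS (p 0) (g * p 0) (p i)
  have e3 := wdist_triangle hS (g * p 0) (g * p j) (p i)
  have e4 := wdist_triangle hS (g * p 0) (p 0) (g * p j)
  have e5 := wdist_triangle hS (p 0) (p i) (g * p j)
  rw [wdist_comm hS (g * p 0) (p 0)] at e4
  rw [wdist_comm hS (p i) (g * p j)] at e5
  rw [wdist_mul_left, hp 0 j (by omega) hj] at e3 e4
  rw [hp 0 i (by omega) hi] at e2 e5
  omega

theorem exists_edgeLink (hX : Subgroup.closure X = ⊤) (hK : CosetBound H X K)
    (hF : FellowTravel (relGen H X)) (k : ℕ) :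
    ∃ T, ∀ l u g p n, Geo (relGen H X) p n → wdist X (p 0) (g * p 0) ≤ k →
      wdist X (p n) (g * p n) ≤ k → ∀ j < n, HasEdge H l u p j →
        T < wdist X (p j) (p (j + 1)) → ∃ i < n, EdgeLink H X l T p u g j i := by
  obtain ⟨T, hT⟩ := exists_coset_penetration hX hK hF k
  refine ⟨T, fun l u g p n hp h0 h1 j hj hpj hlong => ?_⟩
  have key : ∀ v, wdist X v (g * v) ≤ k → AvoidPath H X l u k v (g⁻¹ * v) := fun v hv =>
    (avoidPath_of_wdist hX v (g⁻¹ * v)).mono (by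
      rwa [← wdist_mul_left_eq, wdist_comm hX])
  obtain ⟨i, hi, hqi, hd1, hd2⟩ := hT l u p n (fun i => g⁻¹ * p i) n hp (hp.mul_left _)
    (key _ h0) (key _ h1) j hj hpj hlong
  refine ⟨i, hi, hpj, by simpa [HasEdge.mul_left_iff] using hqi, ?_, ?_⟩
  · rwa [wdist_mul_left_eq]
  · rwa [wdist_mul_left_eq]

/-- A long edge lies between its two neighbouring translates. -/
theorem EdgeLink.between (hX : Subgroup.closure X = ⊤) (hK : CosetBound H X K)
    (hg : ∀ v, v⁻¹ * g * v ∉ H l) (hp : Geo (relGen H X) p n)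
    (h0 : wdist X (p 0) (g * p 0) ≤ k) {j₀ j₁ j₂ : ℕ} (hj0 : j₀ < n) (hj1 : j₁ < n) (hj2 : j₂ < n)
    (hl : EdgeLink H X l T p u g j₀ j₁) (hr : EdgeLink H X l T p (g * u) g j₁ j₂)
    (hlong : K * (2 * k + 4 * T + 1) < wdist X (p j₁) (p (j₁ + 1))) :
    (j₀ < j₁ ∧ j₁ < j₂) ∨ (j₂ < j₁ ∧ j₁ < j₀) := by
  have hne := hl.ne hg
  have hne' := hr.ne hg
  have hi1 := hl.index_le hX hp h0 hj0.le hj1.le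
  have hi2 := hr.index_le hX hp h0 hj1.le hj2.le
  have hgp := hp.mul_left g
  have hpath : ∀ i j, i ≤ j → j ≤ n → (j ≤ j₁ ∨ j₁ < i) →
      AvoidPath H X l (g * u) (j - i) (p i) (p j) := fun i j hij hj hor =>
    hp.avoidPath hX hij hj fun t _ _ ht => by
      have := hp.eq_of_hasEdge hX (by omega) hj1 ht hl.right
      omega
  have hgpath : ∀ i j, i ≤ j → j ≤ n → (j ≤ j₀ ∨ j₀ < i) →
      AvoidPath H X l (g * u) (j - i) (g * p i) (g * p j) := fun i j hij hj hor =>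
    hgp.avoidPath hX hij hj fun t _ _ ht => by
      rw [HasEdge.mul_left_iff, inv_mul_cancel_left] at ht
      have := hp.eq_of_hasEdge hX (by omega) hj0 ht hl.left
      omega
  have hconn : ∀ {v w}, wdist X v w ≤ T → AvoidPath H X l (g * u) T v w := fun h =>
    (avoidPath_of_wdist hX _ _).mono h
  by_contra hcon
  rcases lt_or_gt_of_ne hne with h | h <;> rcases lt_or_gt_of_ne hne' with h' | h'
  · omega
  · have := hK.le hl.right.1 hl.right.2 (N := 2 * k + 4 * T)
      ((((hpath (j₂ + 1) j₁ h' hj1.le (Or.inl le_rfl)).symm.trans (hconn hr.exit).symm).trans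
        (hgpath (j₀ + 1) (j₁ + 1) (by omega) hj1 (Or.inr (by omega))).symm).trans
        (hconn hl.exit)) (by omega)
    omega
  · have := hK.le hl.right.2 hl.right.1 (N := 2 * k + 4 * T)
      ((((hpath (j₁ + 1) j₂ h' hj2.le (Or.inr (by omega))).trans (hconn hr.entry).symm).trans
        (hgpath j₁ j₀ (by omega) hj0.le (Or.inl le_rfl))).trans
        (hconn hl.entry)) (by omega)
    rw [wdist_comm hX] at this
    omega
  · omega

/-- Following the translates of a long edge in increasing direction, the last long one is followed
by a short one. -/
theorem exists_last_edgeLink (hX : Subgroup.closure X = ⊤) (hK : CosetBound H X K)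
    (hg : ∀ v, v⁻¹ * g * v ∉ H l) (hp : Geo (relGen H X) p n)
    (h0 : wdist X (p 0) (g * p 0) ≤ k) {S : ℕ} (hS : K * (2 * k + 4 * T + 1) ≤ S)
    (hlink : ∀ u, ∀ h ∈ ({g, g⁻¹} : Set G), ∀ j < n, HasEdge H l u p j →
      S < wdist X (p j) (p (j + 1)) → ∃ i < n, EdgeLink H X l T p u h j i)
    {j₀ : ℕ} (hj0 : j₀ < j) (hj : j < n) (hl : EdgeLink H X l T p u g j₀ j)
    (hlong : S < wdist X (p j) (p (j + 1))) :
    ∃ h, Commute h g ∧ ∃ i₀ i i₂, i₀ < i ∧ i < i₂ ∧ i₂ < n ∧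
      EdgeLink H X l T p (h * u) g i₀ i ∧ EdgeLink H X l T p (g * (h * u)) g i i₂ ∧
      wdist X (p i₂) (p (i₂ + 1)) ≤ S := by
  obtain ⟨d, hd⟩ : ∃ d, d = n - j := ⟨_, rfl⟩
  induction d using Nat.strong_induction_on generalizing u j j₀ with
  | _ d ih =>
    obtain ⟨i, hi, hr⟩ := hlink _ g (by simp) j hj hl.right hlong
    have hbt := hl.between hX hK hg hp h0 (by omega) hj hi hr (by omega)
    by_cases hshort : wdist X (p i) (p (i + 1)) ≤ S
    · exact ⟨1, Commute.one_left g, j₀, j, i, hj0, by omega, hi, by simpa using hl,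
        by simpa using hr, hshort⟩
    · obtain ⟨h, hh, i₀, i₁, i₂, h1, h2, h3, h4, h5, h6⟩ :=
        ih (n - i) (by omega) (by omega) hi hr (by omega) rfl
      refine ⟨h * g, hh.mul_left (Commute.refl g), i₀, i₁, i₂, h1, h2, h3, ?_, ?_, h6⟩
      · simpa [mul_assoc] using h4
      · simpa [mul_assoc] using h5

/-- Geodesics almost invariant under a hyperbolic element have only short edges. -/
theorem exists_edge_bound (hX : Subgroup.closure X = ⊤) (hK : CosetBound H X K)
    (hF : FellowTravel (relGen H X)) (k : ℕ) :
    ∃ T, ∀ g, (∀ l v, v⁻¹ * g * v ∉ H l) → ∀ p n, Geo (relGen H X) p n →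
      wdist X (p 0) (g * p 0) ≤ k → wdist X (p n) (g * p n) ≤ k →
      ∀ j < n, wdist X (p j) (p (j + 1)) ≤ T := by
  obtain ⟨T, hT⟩ := exists_edgeLink hX hK hF k
  obtain ⟨T', hT'⟩ := exists_coset_penetration hX hK hF 1
  obtain ⟨S, hS1, hS2, hS3⟩ : ∃ S, K * (2 * k + 4 * T + 1) ≤ S ∧ T ≤ S ∧ 1 ≤ S :=
    ⟨K * (2 * k + 4 * T + 1) + T + 1, by omega, by omega, by omega⟩
  have main : ∀ g, (∀ l v, v⁻¹ * g * v ∉ H l) → ∀ p n, Geo (relGen H X) p n →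
      wdist X (p 0) (g * p 0) ≤ k → wdist X (p n) (g * p n) ≤ k →
      (∀ l u, ∀ h ∈ ({g, g⁻¹} : Set G), ∀ j < n, HasEdge H l u p j →
        S < wdist X (p j) (p (j + 1)) → ∃ i < n, EdgeLink H X l T p u h j i) →
      ∀ l u j₀ j j₂, j₀ < j → j < j₂ → j₂ < n → EdgeLink H X l T p u g j₀ j →
        EdgeLink H X l T p (g * u) g j j₂ → S < wdist X (p j) (p (j + 1)) →
        wdist X (p j) (p (j + 1)) ≤ S + 2 * T + 2 * T' := by
    intro g hg p n hp h0 h1 hlink l u j₀ j j₂ hj0 hj2 hjn hl hr hlong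
    obtain ⟨h, hh, i₀, i, i₂, hi0, hi2, hin, hl', hr', hshort⟩ :=
      exists_last_edgeLink hX hK (hg l) hp h0 hS1 (hlink l) hj0 (by omega) hl hlong
    have hcomm : ∀ w, g * (h * w) = h * (g * w) := fun w => by
      rw [← mul_assoc, ← hh.eq, mul_assoc]
    have hclose : ∀ {v w c a b : G}, c⁻¹ * v ∈ H l → c⁻¹ * w ∈ H l → (c = u ∨ c = g * (g * u)) →
        a = v → b = w → AvoidPath H X l (g * u) 1 a b := by
      rintro v w c _ _ hv hw hc rfl rfl
      refine avoidPath_of_wdist_le_one hX (wdist_le_one_of_mem hv hw) fun hcon => ?_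
      rcases hc with rfl | rfl
      · exact hg l c (by
          have := mul_mem hv (inv_mem hcon.1)
          simpa [mul_assoc] using this)
      · exact hg l (g * u) (by
          have := mul_mem hcon.1 (inv_mem hv)
          simpa [mul_assoc] using this)
    by_contra hcon
    obtain ⟨t, ht, hqt, hd1, hd2⟩ := hT' l (g * u) (fun i => p (j₀ + i)) (j₂ - j₀)
      (fun t => h⁻¹ * p (i₀ + t)) (i₂ - i₀) (hp.shift _ _ (by omega))
      ((hp.shift i₀ (i₂ - i₀) (by omega)).mul_left h⁻¹)
      (hclose (c := u) hl.left.1 (by simpa [mul_assoc] using hl'.left.1)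
        (Or.inl rfl) rfl rfl)
      (hclose (c := g * (g * u)) hr.right.1 (w := h⁻¹ * p i₂)
        (by
          have h3 := hr'.right.1
          rwa [hcomm, hcomm, mul_inv_rev, mul_assoc] at h3)
        (Or.inr rfl) (by rw [Nat.add_sub_cancel' (by omega)])
        (by rw [Nat.add_sub_cancel' (by omega)]))
      (j - j₀) (by omega)
      (by
        have := hl.right
        rwa [HasEdge, ← Nat.add_assoc, Nat.add_sub_cancel' hj0.le])
      (by rw [← Nat.add_assoc, Nat.add_sub_cancel' hj0.le]; omega)
    have hti : i₀ + t = i := by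
      refine hp.eq_of_hasEdge hX (by omega) (by omega) (l := l) (u := g * (h * u)) ?_ hl'.right
      have := (HasEdge.mul_left_iff (p := fun t => p (i₀ + t)) h⁻¹).1 hqt
      rwa [inv_inv, ← hcomm] at this
    simp only [← Nat.add_assoc] at hd1 hd2
    rw [Nat.add_sub_cancel' hj0.le, hti] at hd1 hd2
    have e1 := wdist_le_of_close hX hd1 hd2
    rw [wdist_mul_left] at e1
    have e2 := hr'.wdist_le hX
    omega
  refine ⟨S + 2 * T + 2 * T', fun g hg p n hp h0 h1 j hj => ?_⟩
  by_contra! hlong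
  have h0' : wdist X (p 0) (g⁻¹ * p 0) ≤ k := by
    rwa [← wdist_mul_left_eq, wdist_comm hX]
  have h1' : wdist X (p n) (g⁻¹ * p n) ≤ k := by
    rwa [← wdist_mul_left_eq, wdist_comm hX]
  have hg' : ∀ l v, v⁻¹ * g⁻¹ * v ∉ H l := fun l v hv => hg l v (by
    simpa [mul_assoc] using inv_mem hv)
  have hlink : ∀ l u, ∀ h ∈ ({g, g⁻¹} : Set G), ∀ j < n, HasEdge H l u p j →
        S < wdist X (p j) (p (j + 1)) → ∃ i < n, EdgeLink H X l T p u h j i := by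
    rintro l u h (rfl | rfl) j hj hedge hlong
    · exact hT l u _ p n hp h0 h1 j hj hedge (by omega)
    · exact hT l u _ p n hp h0' h1' j hj hedge (by omega)
  have hlink' : ∀ l u, ∀ h ∈ ({g⁻¹, g⁻¹⁻¹} : Set G), ∀ j < n, HasEdge H l u p j →
        S < wdist X (p j) (p (j + 1)) → ∃ i < n, EdgeLink H X l T p u h j i := by
    rw [inv_inv, Set.pair_comm]; exact hlink
  have hH : ∀ l, (p j)⁻¹ * p (j + 1) ∉ H l := by
    intro l hmem
    have hedge : HasEdge H l (p j) p j := ⟨by simp, hmem⟩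
    obtain ⟨i, hi, hr⟩ := hlink l _ g (by simp) j hj hedge (by omega)
    obtain ⟨i', hi', hl⟩ := hlink l _ g⁻¹ (by simp) j hj hedge (by omega)
    have hl' := hl.inv hX
    have hr' := hr.inv hX
    rw [inv_inv] at hl'
    rw [← mul_inv_cancel_left g (p j)] at hr
    rcases hl'.between hX hK (hg l) hp h0 hi' hj hi hr (by omega) with h | h
    · exact absurd (main g hg p n hp h0 h1 hlink l _ i' j i h.1 h.2 hi hl' hr (by omega))
        (by omega)
    · refine absurd (main g⁻¹ hg' p n hp h0' h1' hlink' l _ i j i' h.1 h.2 hi' hr' ?_ (by omega))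
        (by omega)
      simpa using hl
  obtain ⟨l, hl⟩ := exists_mem_of_one_lt_wdist hX
    (show wdist (relGen H X) (p j) (p (j + 1)) ≤ 1 by rw [hp j (j + 1) (by omega) hj]; omega)
    (by omega)
  exact hH l hl

end Translates

section Centralizer

variable {G : Type*} [Group G] {Λ : Type*} {H : Λ → Subgroup G} {X : Set G} {g : G} {K : ℕ}

theorem wdist_le_mul_of_steps (hX : Subgroup.closure X = ⊤) {c : ℕ → G} {E i j : ℕ} (hij : i ≤ j)
    (h : ∀ t, i ≤ t → t < j → wdist X (c t) (c (t + 1)) ≤ E) :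
    wdist X (c i) (c j) ≤ E * (j - i) := by
  induction j, hij using Nat.le_induction with
  | base => simp
  | succ j hij ih =>
    have h1 := ih fun t ht htj => h t ht (by omega)
    have h2 := h j hij (by omega)
    have h3 := wdist_triangle hX (c i) (c j) (c (j + 1))
    rw [Nat.sub_add_comm hij, Nat.mul_succ]
    omega

theorem wdist_le_mul_of_abs_le (hX : Subgroup.closure X = ⊤) {c : ℕ → G} {E n : ℕ}
    (h : ∀ t < n, wdist X (c t) (c (t + 1)) ≤ E) {i j N : ℕ} (hi : i ≤ n) (hj : j ≤ n)
    (hij : i ≤ j + N) (hji : j ≤ i + N) : wdist X (c i) (c j) ≤ E * N := by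
  rcases le_total i j with hle | hle
  · exact (wdist_le_mul_of_steps hX hle fun t _ ht => h t (by omega)).trans
      (Nat.mul_le_mul_left E (by omega))
  · rw [wdist_comm hX]
    exact (wdist_le_mul_of_steps hX hle fun t _ ht => h t (by omega)).trans
      (Nat.mul_le_mul_left E (by omega))

/-- A hyperbolic element almost fixing the endpoints of a geodesic almost fixes all its
vertices. -/
theorem exists_displacement_bound (hX : Subgroup.closure X = ⊤) (hK : CosetBound H X K)
    (hF : FellowTravel (relGen H X)) (hg : ∀ l v, v⁻¹ * g * v ∉ H l) (k : ℕ) :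
    ∃ B, ∀ p n, Geo (relGen H X) p n → wdist X (p 0) (g * p 0) ≤ k →
      wdist X (p n) (g * p n) ≤ k → ∀ i ≤ n, wdist X (p i) (g * p i) ≤ B := by
  have hS := closure_relGen (H := H) hX
  obtain ⟨T, hT⟩ := exists_edge_bound hX hK hF k
  obtain ⟨D, hD⟩ := hF k
  obtain ⟨N, hN⟩ : ∃ N, N = 2 * D + 2 := ⟨_, rfl⟩
  obtain ⟨L, hL⟩ : ∃ L, L = D + T * (N + 2 * (D + k)) + (D + k) + T * N + D := ⟨_, rfl⟩
  refine ⟨(K * (L + 1) + 1) * D + T * (D + k), fun p n hp h0 h1 i hi => ?_⟩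
  have hgp := hp.mul_left g
  have hsteps := hT g hg p n hp h0 h1
  have h0' := (wdist_relGen_le (H := H) hX _ _).trans h0
  have h1' := (wdist_relGen_le (H := H) hX _ _).trans h1
  have hnear : ∀ i ≤ n, ∃ e ≤ n, wdist (relGen H X) (p i) (g * p e) ≤ D ∧
      e ≤ i + (D + k) ∧ i ≤ e + (D + k) := fun i hi => by
    obtain ⟨e, he, hd⟩ := hD p n _ n hp hgp h0' h1' i hi
    refine ⟨e, he, hd, ?_, ?_⟩
    · have e1 := wdist_triangle hS (g * p 0) (p 0) (g * p e)
      have e2 := wdist_triangle hS (p 0) (p i) (g * p e)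
      rw [wdist_comm hS (g * p 0) (p 0), wdist_mul_left, hp 0 e (by omega) he] at e1
      rw [hp 0 i (by omega) hi] at e2
      omega
    · have e1 := wdist_triangle hS (p 0) (g * p 0) (p i)
      have e2 := wdist_triangle hS (g * p 0) (g * p e) (p i)
      rw [wdist_mul_left, hp 0 e (by omega) he, wdist_comm hS (g * p e)] at e2
      rw [hp 0 i (by omega) hi] at e1
      omega
  have hpath : ∀ {l u i j M}, i ≤ n → j ≤ n → i ≤ j + M → j ≤ i + M →
      AvoidPath H X l u (T * M) (p i) (p j) := fun hi hj hij hji =>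
    (avoidPath_of_wdist hX _ _).mono (wdist_le_mul_of_abs_le hX hsteps hi hj hij hji)
  have hgpath : ∀ {l u i j M}, i ≤ n → j ≤ n → i ≤ j + M → j ≤ i + M →
      AvoidPath H X l u (T * M) (g * p i) (g * p j) := fun hi hj hij hji =>
    (avoidPath_of_wdist hX _ _).mono (by
      rw [wdist_mul_left]; exact wdist_le_mul_of_abs_le hX hsteps hi hj hij hji)
  obtain ⟨f, hf, hdf, hf1, hf2⟩ := hnear i hi
  obtain ⟨c, hc0, hc1, hc⟩ := exists_geo hS (p i) (g * p f)
  obtain ⟨m, hm⟩ : ∃ m, m = wdist (relGen H X) (p i) (g * p f) := ⟨_, rfl⟩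
  rw [← hm] at hdf hc hc1
  have hcm : wdist X (c 0) (c m) ≤ (K * (L + 1) + 1) * (m - 0) := by
    refine wdist_le_mul_of_steps hX (Nat.zero_le m) fun t _ ht => ?_
    by_contra! hlong
    obtain ⟨l, hl⟩ := exists_mem_of_one_lt_wdist hX
      (show wdist (relGen H X) (c t) (c (t + 1)) ≤ 1 by rw [hc t (t + 1) (by omega) ht]; omega)
      (by omega)
    have hedge : HasEdge H l (c t) c t := ⟨by simp, hl⟩
    have hleft : AvoidPath H X l (c t) t (p i) (c t) := by
      have := hc.avoidPath (l := l) (u := c t) hX (Nat.zero_le t) ht.le fun s _ hs h =>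
        hs.ne (hc.eq_of_hasEdge hX (by omega) ht h hedge)
      rwa [hc0] at this
    have hright : AvoidPath H X l (c t) (m - (t + 1)) (c (t + 1)) (g * p f) := by
      have := hc.avoidPath (l := l) (u := c t) hX ht le_rfl fun s hs hsm h =>
        (Nat.lt_of_succ_le hs).ne (hc.eq_of_hasEdge hX ht hsm hedge h)
      rwa [hc1] at this
    obtain ⟨i', e, hi', he, hii', hi'i, hei, hie, hconn⟩ : ∃ i' e, i' ≤ n ∧ e ≤ n ∧ i ≤ i' + N ∧
        i' ≤ i + N ∧ e ≤ i' + (D + k) ∧ i' ≤ e + (D + k) ∧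
        AvoidPath H X l (c t) (D + k) (p i') (g * p e) := by
      by_cases hin : i + N ≤ n
      · obtain ⟨e, he, hd, he1, he2⟩ := hnear (i + N) hin
        refine ⟨i + N, e, hin, he, by omega, le_rfl, he1, he2,
          (avoidPath_of_far hX hedge.1 ?_).mono (by omega)⟩
        have e1 := wdist_triangle hS (c 0) (c t) (p (i + N))
        rw [hc 0 t (by omega) ht.le, hc0, hp i (i + N) (by omega) hin] at e1
        omega
      · exact ⟨n, n, le_rfl, le_rfl, by omega, by omega, by omega, by omega,
          (avoidPath_of_wdist hX _ _).mono (by omega)⟩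
    have := hK.le hedge.1 hedge.2 ((((hleft.symm.trans (hpath hi hi' hii' hi'i)).trans hconn).trans
      (hgpath (M := N + 2 * (D + k)) he hf (by omega) (by omega))).trans hright.symm)
      (N := L) (by omega)
    omega
  rw [hc0, hc1, Nat.sub_zero] at hcm
  have e1 := wdist_triangle hX (p i) (g * p f) (g * p i)
  have e2 := wdist_le_mul_of_abs_le hX hsteps hf hi hf1 hf2
  rw [wdist_mul_left] at e1
  have e3 := Nat.mul_le_mul_left (K * (L + 1) + 1) hdf
  omega

theorem RelPath.geo_of_isGeodesic {p : RelPath H X} (hp : IsGeodesic p) :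
    Geo (relGen H X) p.vertex p.len := fun i j hij hj => (hp i j hij hj).symm

/-- An element displaced by a bounded amount is close to the centralizer. -/
theorem exists_centralizer_near (hXfin : X.Finite) (hX : Subgroup.closure X = ⊤) (g : G) (B : ℕ) :
    ∃ M, ∀ v, wdist X v (g * v) ≤ B → ∃ w ∈ Subgroup.centralizer {g}, wdist X v w ≤ M := by
  obtain ⟨M, hM⟩ := exists_nat_bound (finite_setOf_wordLength_le hX hXfin B)
    (P := fun h M => ∀ v, v⁻¹ * (g * v) = h → ∃ w ∈ Subgroup.centralizer {g}, wdist X v w ≤ M)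
    (fun h _ => by
      by_cases hex : ∃ t, t⁻¹ * (g * t) = h
      · obtain ⟨t, ht⟩ := hex
        refine ⟨wordLength X t⁻¹, fun v hv => ⟨v * t⁻¹, ?_, by simp [wdist]⟩⟩
        rw [Subgroup.mem_centralizer_singleton_iff]
        rw [← ht, inv_mul_eq_iff_eq_mul] at hv
        calc v * t⁻¹ * g = v * (t⁻¹ * (g * t)) * t⁻¹ := by group
          _ = g * (v * t⁻¹) := by rw [← hv, mul_assoc]
      · exact ⟨0, fun v hv => (hex ⟨v, hv⟩).elim⟩)
    (fun h M N hMN hP v hv => (hP v hv).imp fun w hw => ⟨hw.1, hw.2.trans hMN⟩)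
  exact ⟨M, fun v hv => hM _ hv v rfl⟩

theorem finite_centralizer_inter (hXfin : X.Finite) (hX : Subgroup.closure X = ⊤)
    (hK : CosetBound H X K) (hg : ∀ l v, v⁻¹ * g * v ∉ H l) (y : G) (l : Λ) :
    {x : G | x ∈ Subgroup.centralizer {g} ∧ y * x * y⁻¹ ∈ H l}.Finite := by
  obtain ⟨M, hM⟩ : ∃ M, M = wordLength X (y * g * y⁻¹) := ⟨_, rfl⟩
  refine ((finite_setOf_wordLength_le hX hXfin (K * (2 * M + 1 + 1))).preimage
    (f := fun x => y * x * y⁻¹) (fun a _ b _ hab => by simpa using hab)).subset ?_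
  rintro x ⟨hx, hxl⟩
  rw [Subgroup.mem_centralizer_singleton_iff] at hx
  obtain ⟨h, hh⟩ : ∃ h, h = y * x * y⁻¹ := ⟨_, rfl⟩
  obtain ⟨a, ha⟩ : ∃ a, a = y * g * y⁻¹ := ⟨_, rfl⟩
  have hcomm : h * a = a * h := by
    rw [hh, ha]
    calc y * x * y⁻¹ * (y * g * y⁻¹) = y * (x * g) * y⁻¹ := by group
      _ = _ := by rw [hx]; group
  have hal : a ∉ H l := fun hmem => hg l y⁻¹ (by rwa [inv_inv, ← ha])
  rw [← hh] at hxl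
  rw [← ha] at hM
  have h1 : AvoidPath H X l 1 M h (h * a) := by
    have := avoidPath_of_wdist (H := H) (l := l) (u := 1) hX h (h * a)
    rwa [wdist, inv_mul_cancel_left, ← hM] at this
  have h2 : AvoidPath H X l 1 1 (h * a) a := by
    refine avoidPath_of_wdist_le_one hX (wdist_relGen_le_one (l := l) ?_) fun hcon => hal ?_
    · simpa [hcomm] using hxl
    · simpa using hcon.2
  have h3 : AvoidPath H X l 1 M a 1 := by
    have := avoidPath_of_wdist (H := H) (l := l) (u := 1) hX a 1
    rwa [wdist, mul_one, wordLength_inv hX, ← hM] at this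
  have := hK.le (by simpa using hxl) (by simp) ((h1.trans h2).trans h3) (N := 2 * M + 1)
    (by omega)
  rw [wdist, mul_one, wordLength_inv hX] at this
  simpa [← hh] using this

theorem stronglyRelQuasiconvex_centralizer (H : Λ → Subgroup G) (hXfin : X.Finite)
    (hX : Subgroup.closure X = ⊤) (hhyp : IsRelHyperbolic H) (hg : IsHypElt H g) :
    StronglyRelQuasiconvex H X (Subgroup.centralizer {g}) := by
  have hS := closure_relGen (H := H) hX
  have hg' : ∀ l v, v⁻¹ * g * v ∉ H l := fun l v hv =>
    hg l _ hv (isConj_iff.2 ⟨v⁻¹, by simp⟩)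
  obtain ⟨K, hK⟩ := exists_avoidPath_bound H hXfin hX hhyp
  obtain ⟨K', hK'⟩ := exists_pathSum_bound H hXfin hS hhyp
  have hF : FellowTravel (relGen H X) := exists_fellowTravel hS hK'
  obtain ⟨B, hB⟩ := exists_displacement_bound hX hK hF hg' (wordLength X g)
  obtain ⟨M, hM⟩ := exists_centralizer_near hXfin hX g B
  have hfix : ∀ v ∈ Subgroup.centralizer {g}, wdist X v (g * v) ≤ wordLength X g := by
    intro v hv
    rw [Subgroup.mem_centralizer_singleton_iff] at hv
    rw [← hv, wdist, inv_mul_cancel_left]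
  refine ⟨⟨M + 1, by positivity, fun p hp h0 h1 i hi => ?_⟩,
    finite_centralizer_inter hXfin hX hK hg'⟩
  obtain ⟨w, hw, hd⟩ := hM _ (hB p.vertex p.len (RelPath.geo_of_isGeodesic hp)
    (hfix _ (by simpa [RelPath.vertex] using h0)) (hfix _ h1) i hi)
  refine ⟨w, hw, ?_⟩
  have : (xDist X (p.vertex i) w : ℝ) ≤ M := by exact_mod_cast hd
  linarith

end Centralizer

end RelHyp

/-- Theorem 4.19. Let `G` be generated by a finite set `X` and hyperbolic
relative to `{H₁,…,H_m}`. For every hyperbolic element `g ∈ G`, the centralizer `C(g)` of `g`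
is a strongly relatively quasi-convex subgroup of `G`. -/
theorem statement_18 {G : Type*} [Group G] {m : ℕ} (H : Fin m → Subgroup G)
    (X : Set G) (hXfin : X.Finite) (hXgen : Subgroup.closure X = ⊤)
    (hhyp : IsRelHyperbolic H) (g : G) (hg : IsHypElt H g) :
    StronglyRelQuasiconvex H X (Subgroup.centralizer {g}) := by
  exact stronglyRelQuasiconvex_centralizer H hXfin hXgen hhyp hg
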